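/- arXiv:1211.5701 — 16 statements merged into one kernel-verified Lean document; each statement's English description precedes it below -/
import Mathlib

section
/- Let (a_n) be a sequence of nonnegative real numbers satisfying a_{n+1} ≤ (1 − μ_n) a_n + ρ_n for all n ≥ n_0, where μ_n ∈ (0,1) for all n ≥ n_0, the series ∑ μ_n diverges, and ρ_n = o(μ_n) (i.e. ρ_n/μ_n → 0 as n → ∞). Then lim_{n→∞} a_n = 0. -/
open Filter Topology

theorem stmt0 (a μ ρ : ℕ → ℝ) (n₀ : ℕ)
    (ha : ∀ n, 0 ≤ a n)
    (hrec : ∀ n, n₀ ≤ n → a (n+1) ≤ (1 - μ n) * a n + ρ n)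
    (hμ : ∀ n, n₀ ≤ n → μ n ∈ Set.Ioo (0:ℝ) 1)
    (hdiv : Tendsto (fun N => ∑ n ∈ Finset.range N, μ n) atTop atTop)
    (hsmall : Tendsto (fun n => ρ n / μ n) atTop (𝓝 0)) :
    Tendsto a atTop (𝓝 0) := by
  rw [Metric.tendsto_atTop]
  intro ε hε
  obtain ⟨N₁, hN₁⟩ := eventually_atTop.1 (hsmall.eventually (gt_mem_nhds (half_pos hε)))
  set N := max n₀ N₁ with hN
  set S : ℕ → ℝ := fun N => ∑ n ∈ Finset.range N, μ n with hS
  set C : ℝ := |a N - ε / 2| with hC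
  have key : ∀ n, N ≤ n → a n - ε / 2 ≤ C * Real.exp (-(S n - S N)) := by
    intro n hn
    induction n, hn using Nat.le_induction with
    | base => simpa using le_abs_self (a N - ε / 2)
    | succ n hn ih =>
      have h0 : n₀ ≤ n := le_trans (le_max_left _ _) hn
      have h1 : N₁ ≤ n := le_trans (le_max_right _ _) hn
      obtain ⟨hm0, hm1⟩ := hμ n h0
      have hr : ρ n < ε / 2 * μ n := (div_lt_iff₀ hm0).1 (hN₁ n h1)
      have hSs : S (n+1) = S n + μ n := Finset.sum_range_succ _ _
      have he : Real.exp (-(S (n+1) - S N)) = Real.exp (-μ n) * Real.exp (-(S n - S N)) := by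
        rw [← Real.exp_add, hSs]; congr 1; ring
      have hone : 1 - μ n ≤ Real.exp (-μ n) := by
        have := Real.add_one_le_exp (-μ n)
        linarith
      have hnn : 0 ≤ C * Real.exp (-(S n - S N)) :=
        mul_nonneg (abs_nonneg _) (Real.exp_pos _).le
      calc a (n+1) - ε / 2 ≤ (1 - μ n) * (a n - ε / 2) := by
            have := hrec n h0
            linarith
        _ ≤ (1 - μ n) * (C * Real.exp (-(S n - S N))) :=
            mul_le_mul_of_nonneg_left ih (by linarith)
        _ ≤ Real.exp (-μ n) * (C * Real.exp (-(S n - S N))) :=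
            mul_le_mul_of_nonneg_right hone hnn
        _ = C * Real.exp (-(S (n+1) - S N)) := by rw [he]; ring
  have hlim : Tendsto (fun n => C * Real.exp (-(S n - S N))) atTop (𝓝 0) := by
    have h1 : Tendsto (fun n => S n - S N) atTop atTop :=
      tendsto_atTop_add_const_right _ (-S N) hdiv
    simpa using (Real.tendsto_exp_neg_atTop_nhds_zero.comp h1).const_mul C
  obtain ⟨M, hM⟩ := eventually_atTop.1 (hlim.eventually (gt_mem_nhds (half_pos hε)))
  refine ⟨max N M, fun n hn => ?_⟩
  have h1 := key n (le_trans (le_max_left _ _) hn)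
  have h2 := hM n (le_trans (le_max_right _ _) hn)
  rw [Real.dist_eq, sub_zero, abs_of_nonneg (ha n)]
  linarith
end

section
/- Let X be a real Banach space, E a nonempty closed convex subset of X, T : E → E a contractive-like map with fixed point p, and fix k ≥ 2. Let (α_n) and (β_n^i), i = 1,…,k−1, be sequences in [0,1) with α_n ≥ A > 0 for all n. Let (u_n) be the Mann iteration and (x_n) the new multistep iteration, both started at the same point u_0 = x_0 ∈ E. If u_n → p, then x_n → p. -/
open Filter Topology

theorem stmt2 {X : Type*} [NormedAddCommGroup X] [NormedSpace ℝ X] [CompleteSpace X]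
    {E : Set X} (hEne : E.Nonempty) (hEcl : IsClosed E) (hEcv : Convex ℝ E)
    {T : X → X} (hTE : Set.MapsTo T E E)
    {δ : ℝ} (hδ0 : 0 ≤ δ) (hδ1 : δ < 1)
    {φ : ℝ → ℝ} (hφ0 : φ 0 = 0) (hφmono : StrictMonoOn φ (Set.Ici 0))
    (hφcont : ContinuousOn φ (Set.Ici 0)) (hφnonneg : ∀ t, 0 ≤ t → 0 ≤ φ t)
    (hT : ∀ x ∈ E, ∀ y ∈ E, ‖T x - T y‖ ≤ δ * ‖x - y‖ + φ ‖x - T x‖)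
    {p : X} (hpE : p ∈ E) (hfix : T p = p)
    (α : ℕ → ℝ) (hα : ∀ n, α n ∈ Set.Ico (0:ℝ) 1)
    {A : ℝ} (hA0 : 0 < A) (hαA : ∀ n, A ≤ α n)
    (u : ℕ → X) (hu0 : u 0 ∈ E)
    (hu : ∀ n, u (n+1) = (1 - α n) • u n + α n • T (u n))
    (k : ℕ) (hk : 2 ≤ k)
    (β : ℕ → ℕ → ℝ) (hβ : ∀ n i, 1 ≤ i → i ≤ k - 1 → β n i ∈ Set.Ico (0:ℝ) 1)
    (x : ℕ → X) (y : ℕ → ℕ → X) (hx0 : x 0 = u 0)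
    (hytop : ∀ n, y n (k-1) = (1 - β n (k-1)) • x n + β n (k-1) • T (x n))
    (hyi : ∀ n i, 1 ≤ i → i ≤ k - 2 →
      y n i = (1 - β n i) • y n (i+1) + β n i • T (y n (i+1)))
    (hx : ∀ n, x (n+1) = (1 - α n) • y n 1 + α n • T (y n 1))
    : Tendsto u atTop (𝓝 p) → Tendsto x atTop (𝓝 p) := by
  intro _
  have step : ∀ z ∈ E, ∀ t ∈ Set.Ico (0:ℝ) 1,
      (1 - t) • z + t • T z ∈ E ∧
        ‖(1 - t) • z + t • T z - p‖ ≤ (1 - t * (1 - δ)) * ‖z - p‖ := by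
    intro z hz t ht
    have h1 : 0 ≤ 1 - t := by linarith [ht.2]
    refine ⟨hEcv hz (hTE hz) h1 ht.1 (by ring), ?_⟩
    have h2 := hT p hpE z hz
    rw [hfix, sub_self, norm_zero, hφ0, add_zero, norm_sub_rev, norm_sub_rev p z] at h2
    have h3 : (1 - t) • z + t • T z - p = (1 - t) • (z - p) + t • (T z - p) := by
      module
    rw [h3]
    calc _ ≤ ‖(1 - t) • (z - p)‖ + ‖t • (T z - p)‖ := norm_add_le _ _
      _ = (1 - t) * ‖z - p‖ + t * ‖T z - p‖ := by
        rw [norm_smul, norm_smul, Real.norm_of_nonneg h1, Real.norm_of_nonneg ht.1]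
      _ ≤ (1 - t) * ‖z - p‖ + t * (δ * ‖z - p‖) := by
        have := mul_le_mul_of_nonneg_left h2 ht.1
        linarith
      _ = _ := by ring
  have step' : ∀ z ∈ E, ∀ t ∈ Set.Ico (0:ℝ) 1,
      ‖(1 - t) • z + t • T z - p‖ ≤ ‖z - p‖ := by
    intro z hz t ht
    refine (step z hz t ht).2.trans ?_
    have h1 : 0 ≤ t * (1 - δ) := mul_nonneg ht.1 (by linarith)
    have h2 := mul_nonneg h1 (norm_nonneg (z - p))
    linarith
  have hy : ∀ n, x n ∈ E → ∀ j, j ≤ k - 2 →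
      y n (k - 1 - j) ∈ E ∧ ‖y n (k - 1 - j) - p‖ ≤ ‖x n - p‖ := by
    intro n hn j
    induction j with
    | zero =>
      intro _
      have hb := hβ n (k - 1) (by omega) le_rfl
      rw [Nat.sub_zero, hytop n]
      exact ⟨(step _ hn _ hb).1, step' _ hn _ hb⟩
    | succ j ih =>
      intro hj
      obtain ⟨h1, h2⟩ := ih (by omega)
      have hb := hβ n (k - 1 - (j + 1)) (by omega) (by omega)
      have he : k - 1 - (j + 1) + 1 = k - 1 - j := by omega
      rw [hyi n (k - 1 - (j + 1)) (by omega) (by omega), he]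
      exact ⟨(step _ h1 _ hb).1, (step' _ h1 _ hb).trans h2⟩
  have hy1 : ∀ n, x n ∈ E → y n 1 ∈ E ∧ ‖y n 1 - p‖ ≤ ‖x n - p‖ := by
    intro n hn
    have h := hy n hn (k - 2) le_rfl
    have he : k - 1 - (k - 2) = 1 := by omega
    rwa [he] at h
  have hA1 : A < 1 := (hαA 0).trans_lt (hα 0).2
  have hq0 : 0 ≤ 1 - A * (1 - δ) := by nlinarith
  have hq1 : 1 - A * (1 - δ) < 1 := by nlinarith
  have main : ∀ n, x n ∈ E ∧ ‖x n - p‖ ≤ (1 - A * (1 - δ)) ^ n * ‖x 0 - p‖ := by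
    intro n
    induction n with
    | zero => exact ⟨hx0 ▸ hu0, by simp⟩
    | succ n ih =>
      obtain ⟨h1, h2⟩ := ih
      obtain ⟨h3, h4⟩ := hy1 n h1
      obtain ⟨h5, h6⟩ := step _ h3 _ (hα n)
      rw [← hx n] at h5 h6
      refine ⟨h5, h6.trans ?_⟩
      have h7 : 1 - α n * (1 - δ) ≤ 1 - A * (1 - δ) := by
        have := mul_le_mul_of_nonneg_right (hαA n) (by linarith : 0 ≤ 1 - δ)
        linarith
      calc _ ≤ (1 - A * (1 - δ)) * ((1 - A * (1 - δ)) ^ n * ‖x 0 - p‖) :=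
            mul_le_mul h7 (h4.trans h2) (norm_nonneg _) hq0
        _ = _ := by ring
  rw [tendsto_iff_norm_sub_tendsto_zero]
  refine squeeze_zero (fun _ => norm_nonneg _) (fun n => (main n).2) ?_
  simpa using (tendsto_pow_atTop_nhds_zero_of_lt_one hq0 hq1).mul_const ‖x 0 - p‖
end

section
/- Let X be a real Banach space, E a nonempty closed convex subset of X, T : E → E a contractive-like map with fixed point p, and fix k ≥ 2. Let (α_n) and (β_n^i), i = 1,…,k−1, be sequences in [0,1) with α_n ≥ A > 0 for all n. Let (u_n) be the Mann iteration and (x_n) the new multistep iteration, both started at the same point u_0 = x_0 ∈ E. Then u_n → p if and only if x_n → p. -/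
open Filter Topology

theorem stmt4 {X : Type*} [NormedAddCommGroup X] [NormedSpace ℝ X] [CompleteSpace X]
    {E : Set X} (hEne : E.Nonempty) (hEcl : IsClosed E) (hEcv : Convex ℝ E)
    {T : X → X} (hTE : Set.MapsTo T E E)
    {δ : ℝ} (hδ0 : 0 ≤ δ) (hδ1 : δ < 1)
    {φ : ℝ → ℝ} (hφ0 : φ 0 = 0) (hφmono : StrictMonoOn φ (Set.Ici 0))
    (hφcont : ContinuousOn φ (Set.Ici 0)) (hφnonneg : ∀ t, 0 ≤ t → 0 ≤ φ t)
    (hT : ∀ x ∈ E, ∀ y ∈ E, ‖T x - T y‖ ≤ δ * ‖x - y‖ + φ ‖x - T x‖)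
    {p : X} (hpE : p ∈ E) (hfix : T p = p)
    (α : ℕ → ℝ) (hα : ∀ n, α n ∈ Set.Ico (0:ℝ) 1)
    {A : ℝ} (hA0 : 0 < A) (hαA : ∀ n, A ≤ α n)
    (u : ℕ → X) (hu0 : u 0 ∈ E)
    (hu : ∀ n, u (n+1) = (1 - α n) • u n + α n • T (u n))
    (k : ℕ) (hk : 2 ≤ k)
    (β : ℕ → ℕ → ℝ) (hβ : ∀ n i, 1 ≤ i → i ≤ k - 1 → β n i ∈ Set.Ico (0:ℝ) 1)
    (x : ℕ → X) (y : ℕ → ℕ → X) (hx0 : x 0 = u 0)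
    (hytop : ∀ n, y n (k-1) = (1 - β n (k-1)) • x n + β n (k-1) • T (x n))
    (hyi : ∀ n i, 1 ≤ i → i ≤ k - 2 →
      y n i = (1 - β n i) • y n (i+1) + β n i • T (y n (i+1)))
    (hx : ∀ n, x (n+1) = (1 - α n) • y n 1 + α n • T (y n 1))
    : Tendsto u atTop (𝓝 p) ↔ Tendsto x atTop (𝓝 p) := by
  have hTp : ∀ z ∈ E, ‖T z - p‖ ≤ δ * ‖z - p‖ := by
    intro z hz
    have h := hT p hpE z hz
    rw [hfix, sub_self, norm_zero, hφ0, add_zero] at h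
    rwa [norm_sub_rev (T z), norm_sub_rev z]
  have step : ∀ z ∈ E, ∀ a ∈ Set.Ico (0:ℝ) 1, ((1 - a) • z + a • T z) ∈ E ∧
      ‖((1 - a) • z + a • T z) - p‖ ≤ (1 - a * (1 - δ)) * ‖z - p‖ := by
    intro z hz a ha
    obtain ⟨ha0, ha1⟩ := ha
    refine ⟨hEcv hz (hTE hz) (by linarith) ha0 (by ring), ?_⟩
    have e : ((1 - a) • z + a • T z) - p = (1 - a) • (z - p) + a • (T z - p) := by
      module
    rw [e]
    refine (norm_add_le _ _).trans ?_
    rw [norm_smul, norm_smul, Real.norm_of_nonneg ha0,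
      Real.norm_of_nonneg (by linarith : (0:ℝ) ≤ 1 - a)]
    have := mul_le_mul_of_nonneg_left (hTp z hz) ha0
    linarith
  have hA1 : A < 1 := (hαA 0).trans_lt (hα 0).2
  have hr0 : 0 ≤ 1 - A * (1 - δ) := by nlinarith
  have hr1 : 1 - A * (1 - δ) < 1 := by nlinarith
  have conv : ∀ v : ℕ → X, v 0 ∈ E →
      (∀ n, v n ∈ E → v (n+1) ∈ E ∧ ‖v (n+1) - p‖ ≤ (1 - A * (1 - δ)) * ‖v n - p‖) →
      Tendsto v atTop (𝓝 p) := by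
    intro v hv0 hv
    have hb : ∀ n, v n ∈ E ∧ ‖v n - p‖ ≤ (1 - A * (1 - δ)) ^ n * ‖v 0 - p‖ := by
      intro n
      induction n with
      | zero => exact ⟨hv0, by simp⟩
      | succ n ih =>
        obtain ⟨h1, h2⟩ := hv n ih.1
        refine ⟨h1, h2.trans ?_⟩
        rw [pow_succ', mul_assoc]
        exact mul_le_mul_of_nonneg_left ih.2 hr0
    rw [tendsto_iff_norm_sub_tendsto_zero]
    refine squeeze_zero (fun _ => norm_nonneg _) (fun n => (hb n).2) ?_
    simpa using (tendsto_pow_atTop_nhds_zero_of_lt_one hr0 hr1).mul_const ‖v 0 - p‖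
  have stepα : ∀ n, ∀ z ∈ E, ((1 - α n) • z + α n • T z) ∈ E ∧
      ‖((1 - α n) • z + α n • T z) - p‖ ≤ (1 - A * (1 - δ)) * ‖z - p‖ := by
    intro n z hz
    refine ⟨(step z hz _ (hα n)).1, (step z hz _ (hα n)).2.trans ?_⟩
    have := mul_le_mul_of_nonneg_right (hαA n) (by linarith : (0:ℝ) ≤ 1 - δ)
    exact mul_le_mul_of_nonneg_right (by linarith) (norm_nonneg _)
  have stepβ : ∀ z ∈ E, ∀ a ∈ Set.Ico (0:ℝ) 1, ((1 - a) • z + a • T z) ∈ E ∧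
      ‖((1 - a) • z + a • T z) - p‖ ≤ ‖z - p‖ := by
    intro z hz a ha
    refine ⟨(step z hz a ha).1, (step z hz a ha).2.trans ?_⟩
    have := mul_nonneg ha.1 (by linarith : (0:ℝ) ≤ 1 - δ)
    exact mul_le_of_le_one_left (norm_nonneg _) (by linarith)
  have hU : Tendsto u atTop (𝓝 p) := by
    refine conv u hu0 fun n hn => ?_
    rw [hu n]
    exact stepα n _ hn
  have hX : Tendsto x atTop (𝓝 p) := by
    refine conv x (hx0 ▸ hu0) fun n hn => ?_
    have hy : ∀ j, j ≤ k - 2 → y n (k - 1 - j) ∈ E ∧ ‖y n (k - 1 - j) - p‖ ≤ ‖x n - p‖ := by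
      intro j
      induction j with
      | zero =>
        intro _
        rw [Nat.sub_zero, hytop n]
        exact stepβ _ hn _ (hβ n _ (by omega) le_rfl)
      | succ j ih =>
        intro hj
        obtain ⟨h1, h2⟩ := ih (by omega)
        have e : k - 1 - (j + 1) + 1 = k - 1 - j := by omega
        rw [hyi n (k - 1 - (j + 1)) (by omega) (by omega), e]
        obtain ⟨h3, h4⟩ := stepβ _ h1 _ (hβ n (k - 1 - (j + 1)) (by omega) (by omega))
        exact ⟨h3, h4.trans h2⟩
    obtain ⟨h1, h2⟩ := hy (k - 2) le_rfl
    rw [show k - 1 - (k - 2) = 1 by omega] at h1 h2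
    rw [hx n]
    obtain ⟨h3, h4⟩ := stepα n _ h1
    exact ⟨h3, h4.trans (mul_le_mul_of_nonneg_left h2 hr0)⟩
  exact ⟨fun _ => hX, fun _ => hU⟩
end

section
/- Let X be a real Banach space, E a nonempty closed convex subset of X, and T : E → E a contractive-like map with fixed point p. Let (α_n) and (β_n) be sequences in [0,1) with α_n ≥ A > 0 for all n. Let (u_n) be the Mann iteration and (x_n) the S-iteration, both started at the same point u_0 = x_0 ∈ E. If u_n → p, then x_n → p. -/
open Filter Topology

theorem stmt5 {X : Type*} [NormedAddCommGroup X] [NormedSpace ℝ X] [CompleteSpace X]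
    {E : Set X} (hEne : E.Nonempty) (hEcl : IsClosed E) (hEcv : Convex ℝ E)
    {T : X → X} (hTE : Set.MapsTo T E E)
    {δ : ℝ} (hδ0 : 0 ≤ δ) (hδ1 : δ < 1)
    {φ : ℝ → ℝ} (hφ0 : φ 0 = 0) (hφmono : StrictMonoOn φ (Set.Ici 0))
    (hφcont : ContinuousOn φ (Set.Ici 0)) (hφnonneg : ∀ t, 0 ≤ t → 0 ≤ φ t)
    (hT : ∀ x ∈ E, ∀ y ∈ E, ‖T x - T y‖ ≤ δ * ‖x - y‖ + φ ‖x - T x‖)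
    {p : X} (hpE : p ∈ E) (hfix : T p = p)
    (α : ℕ → ℝ) (hα : ∀ n, α n ∈ Set.Ico (0:ℝ) 1)
    {A : ℝ} (hA0 : 0 < A) (hαA : ∀ n, A ≤ α n)
    (u : ℕ → X) (hu0 : u 0 ∈ E)
    (hu : ∀ n, u (n+1) = (1 - α n) • u n + α n • T (u n))
    (β : ℕ → ℝ) (hβ : ∀ n, β n ∈ Set.Ico (0:ℝ) 1)
    (x y : ℕ → X) (hx0 : x 0 = u 0)
    (hy : ∀ n, y n = (1 - β n) • x n + β n • T (x n))
    (hx : ∀ n, x (n+1) = (1 - α n) • T (x n) + α n • T (y n))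
    : Tendsto u atTop (𝓝 p) → Tendsto x atTop (𝓝 p) := by
  intro _
  have key : ∀ z ∈ E, ‖T z - p‖ ≤ δ * ‖z - p‖ := by
    intro z hz
    have h := hT p hpE z hz
    rw [hfix, sub_self, norm_zero, hφ0, add_zero] at h
    rwa [norm_sub_rev, norm_sub_rev z p]
  have conv : ∀ (t : ℝ) (a b : X) (r : ℝ), 0 ≤ t → t < 1 → ‖a - p‖ ≤ r → ‖b - p‖ ≤ r →
      ‖((1 - t) • a + t • b) - p‖ ≤ r := by
    intro t a b r h0 h1 ha hb
    have e : ((1 - t) • a + t • b) - p = (1 - t) • (a - p) + t • (b - p) := by module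
    rw [e]
    refine (norm_add_le _ _).trans ?_
    rw [norm_smul, norm_smul, Real.norm_of_nonneg h0, Real.norm_of_nonneg (by linarith)]
    nlinarith [mul_le_mul_of_nonneg_left ha (by linarith : 0 ≤ 1 - t),
      mul_le_mul_of_nonneg_left hb h0]
  have hind : ∀ n, x n ∈ E ∧ ‖x n - p‖ ≤ δ ^ n * ‖x 0 - p‖ := by
    intro n
    induction n with
    | zero => exact ⟨hx0 ▸ hu0, by simp⟩
    | succ n ih =>
      obtain ⟨hE, hn⟩ := ih
      have hyE : y n ∈ E := by
        rw [hy]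
        exact hEcv hE (hTE hE) (by linarith [(hβ n).2]) (hβ n).1 (by ring)
      have hTx := key _ hE
      have hyn : ‖y n - p‖ ≤ ‖x n - p‖ := by
        rw [hy]
        refine conv _ _ _ _ (hβ n).1 (hβ n).2 le_rfl (hTx.trans ?_)
        nlinarith [norm_nonneg (x n - p)]
      have hTy := (key _ hyE).trans (mul_le_mul_of_nonneg_left hyn hδ0)
      constructor
      · rw [hx]
        exact hEcv (hTE hE) (hTE hyE) (by linarith [(hα n).2]) (hα n).1 (by ring)
      · have h := conv _ _ _ _ (hα n).1 (hα n).2 hTx hTy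
        rw [← hx] at h
        refine h.trans ((mul_le_mul_of_nonneg_left hn hδ0).trans_eq ?_)
        ring
  rw [tendsto_iff_norm_sub_tendsto_zero]
  refine squeeze_zero (fun n => norm_nonneg _) (fun n => (hind n).2) ?_
  simpa using (tendsto_pow_atTop_nhds_zero_of_lt_one hδ0 hδ1).mul_const ‖x 0 - p‖
end

section
/- Let X be a real Banach space, E a nonempty closed convex subset of X, and T : E → E a contractive-like map with fixed point p. Let (α_n) and (β_n) be sequences in [0,1) with α_n ≥ A > 0 for all n. Let (u_n) be the Mann iteration and (x_n) the S-iteration, both started at the same point u_0 = x_0 ∈ E. If x_n → p, then u_n → p. -/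
open Filter Topology

theorem stmt6 {X : Type*} [NormedAddCommGroup X] [NormedSpace ℝ X] [CompleteSpace X]
    {E : Set X} (hEne : E.Nonempty) (hEcl : IsClosed E) (hEcv : Convex ℝ E)
    {T : X → X} (hTE : Set.MapsTo T E E)
    {δ : ℝ} (hδ0 : 0 ≤ δ) (hδ1 : δ < 1)
    {φ : ℝ → ℝ} (hφ0 : φ 0 = 0) (hφmono : StrictMonoOn φ (Set.Ici 0))
    (hφcont : ContinuousOn φ (Set.Ici 0)) (hφnonneg : ∀ t, 0 ≤ t → 0 ≤ φ t)
    (hT : ∀ x ∈ E, ∀ y ∈ E, ‖T x - T y‖ ≤ δ * ‖x - y‖ + φ ‖x - T x‖)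
    {p : X} (hpE : p ∈ E) (hfix : T p = p)
    (α : ℕ → ℝ) (hα : ∀ n, α n ∈ Set.Ico (0:ℝ) 1)
    {A : ℝ} (hA0 : 0 < A) (hαA : ∀ n, A ≤ α n)
    (u : ℕ → X) (hu0 : u 0 ∈ E)
    (hu : ∀ n, u (n+1) = (1 - α n) • u n + α n • T (u n))
    (β : ℕ → ℝ) (hβ : ∀ n, β n ∈ Set.Ico (0:ℝ) 1)
    (x y : ℕ → X) (hx0 : x 0 = u 0)
    (hy : ∀ n, y n = (1 - β n) • x n + β n • T (x n))
    (hx : ∀ n, x (n+1) = (1 - α n) • T (x n) + α n • T (y n))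
    : Tendsto x atTop (𝓝 p) → Tendsto u atTop (𝓝 p) := by
  intro _
  have hE : ∀ n, u n ∈ E := by
    intro n
    induction n with
    | zero => exact hu0
    | succ k ih =>
      rw [hu k]
      exact hEcv ih (hTE ih) (by linarith [(hα k).2]) (hα k).1 (by ring)
  have hTp : ∀ z ∈ E, ‖T z - p‖ ≤ δ * ‖z - p‖ := by
    intro z hz
    have h := hT p hpE z hz
    rw [hfix, sub_self, norm_zero, hφ0, add_zero, norm_sub_rev p, norm_sub_rev p] at h
    exact h
  have hA1 : A < 1 := lt_of_le_of_lt (hαA 0) (hα 0).2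
  have hr0 : 0 ≤ 1 - A * (1 - δ) := by nlinarith
  have hr1 : 1 - A * (1 - δ) < 1 := by nlinarith
  have step : ∀ n, ‖u (n+1) - p‖ ≤ (1 - A * (1 - δ)) * ‖u n - p‖ := by
    intro n
    have e : u (n+1) - p = (1 - α n) • (u n - p) + α n • (T (u n) - p) := by
      rw [hu n]; module
    have h0 := (hα n).1
    have h1 : 0 ≤ 1 - α n := by linarith [(hα n).2]
    have h2 := norm_add_le ((1 - α n) • (u n - p)) (α n • (T (u n) - p))
    rw [← e, norm_smul, norm_smul, Real.norm_of_nonneg h0, Real.norm_of_nonneg h1] at h2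
    have h3 := mul_le_mul_of_nonneg_left (hTp _ (hE n)) h0
    have h4 : 0 ≤ (α n - A) * ((1 - δ) * ‖u n - p‖) :=
      mul_nonneg (by linarith [hαA n]) (mul_nonneg (by linarith) (norm_nonneg _))
    nlinarith
  have bound : ∀ n, ‖u n - p‖ ≤ (1 - A * (1 - δ)) ^ n * ‖u 0 - p‖ := by
    intro n
    induction n with
    | zero => simp
    | succ k ih =>
      calc ‖u (k+1) - p‖ ≤ (1 - A * (1 - δ)) * ‖u k - p‖ := step k
        _ ≤ (1 - A * (1 - δ)) * ((1 - A * (1 - δ)) ^ k * ‖u 0 - p‖) :=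
          mul_le_mul_of_nonneg_left ih hr0
        _ = _ := by ring
  rw [tendsto_iff_norm_sub_tendsto_zero]
  refine squeeze_zero (fun _ => norm_nonneg _) bound ?_
  simpa using (tendsto_pow_atTop_nhds_zero_of_lt_one hr0 hr1).mul_const ‖u 0 - p‖
end

section
/- Let X be a real Banach space, E a nonempty closed convex subset of X, and T : E → E a contractive-like map with fixed point p. Let (α_n) and (β_n) be sequences in [0,1) with α_n ≥ A > 0 for all n. Let (u_n) be the Mann iteration and (x_n) the S-iteration, both started at the same point u_0 = x_0 ∈ E. Then u_n → p if and only if x_n → p. -/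
open Filter Topology

lemma aux_tendsto {X : Type*} [NormedAddCommGroup X] (z : ℕ → X) (p : X) (c : ℝ)
    (h0 : 0 ≤ c) (h1 : c < 1) (h : ∀ n, ‖z (n+1) - p‖ ≤ c * ‖z n - p‖) :
    Tendsto z atTop (𝓝 p) := by
  rw [tendsto_iff_norm_sub_tendsto_zero]
  have hb : ∀ n, ‖z n - p‖ ≤ c ^ n * ‖z 0 - p‖ := by
    intro n
    induction n with
    | zero => simp
    | succ k ih =>
      calc ‖z (k+1) - p‖ ≤ c * ‖z k - p‖ := h k
        _ ≤ c * (c ^ k * ‖z 0 - p‖) := mul_le_mul_of_nonneg_left ih h0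
        _ = c ^ (k+1) * ‖z 0 - p‖ := by ring
  refine squeeze_zero (fun n => norm_nonneg _) hb ?_
  simpa using (tendsto_pow_atTop_nhds_zero_of_lt_one h0 h1).mul_const ‖z 0 - p‖

lemma aux_conv {X : Type*} [NormedAddCommGroup X] [NormedSpace ℝ X] (v w p : X) (a : ℝ)
    (h0 : 0 ≤ a) (h1 : a < 1) :
    ‖(1 - a) • v + a • w - p‖ ≤ (1 - a) * ‖v - p‖ + a * ‖w - p‖ := by
  have e : (1 - a) • v + a • w - p = (1 - a) • (v - p) + a • (w - p) := by module
  rw [e]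
  refine (norm_add_le _ _).trans ?_
  rw [norm_smul, norm_smul, Real.norm_of_nonneg h0, Real.norm_of_nonneg (by linarith)]

theorem stmt7 {X : Type*} [NormedAddCommGroup X] [NormedSpace ℝ X] [CompleteSpace X]
    {E : Set X} (hEne : E.Nonempty) (hEcl : IsClosed E) (hEcv : Convex ℝ E)
    {T : X → X} (hTE : Set.MapsTo T E E)
    {δ : ℝ} (hδ0 : 0 ≤ δ) (hδ1 : δ < 1)
    {φ : ℝ → ℝ} (hφ0 : φ 0 = 0) (hφmono : StrictMonoOn φ (Set.Ici 0))
    (hφcont : ContinuousOn φ (Set.Ici 0)) (hφnonneg : ∀ t, 0 ≤ t → 0 ≤ φ t)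
    (hT : ∀ x ∈ E, ∀ y ∈ E, ‖T x - T y‖ ≤ δ * ‖x - y‖ + φ ‖x - T x‖)
    {p : X} (hpE : p ∈ E) (hfix : T p = p)
    (α : ℕ → ℝ) (hα : ∀ n, α n ∈ Set.Ico (0:ℝ) 1)
    {A : ℝ} (hA0 : 0 < A) (hαA : ∀ n, A ≤ α n)
    (u : ℕ → X) (hu0 : u 0 ∈ E)
    (hu : ∀ n, u (n+1) = (1 - α n) • u n + α n • T (u n))
    (β : ℕ → ℝ) (hβ : ∀ n, β n ∈ Set.Ico (0:ℝ) 1)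
    (x y : ℕ → X) (hx0 : x 0 = u 0)
    (hy : ∀ n, y n = (1 - β n) • x n + β n • T (x n))
    (hx : ∀ n, x (n+1) = (1 - α n) • T (x n) + α n • T (y n))
    : Tendsto u atTop (𝓝 p) ↔ Tendsto x atTop (𝓝 p) := by
  have hTp : ∀ z ∈ E, ‖T z - p‖ ≤ δ * ‖z - p‖ := by
    intro z hz
    have := hT p hpE z hz
    rw [hfix, sub_self, norm_zero, hφ0, add_zero] at this
    rwa [norm_sub_rev, norm_sub_rev z p]
  have hc : ∀ a ∈ Set.Ico (0:ℝ) 1, ∀ v ∈ E, ∀ w ∈ E, (1 - a) • v + a • w ∈ E := by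
    intro a ha v hv w hw
    exact hEcv hv hw (by linarith [ha.2]) ha.1 (by ring)
  have huE : ∀ n, u n ∈ E := by
    intro n
    induction n with
    | zero => exact hu0
    | succ k ih => rw [hu]; exact hc _ (hα k) _ ih _ (hTE ih)
  have hyE : ∀ n, x n ∈ E → y n ∈ E := by
    intro n h
    rw [hy]; exact hc _ (hβ n) _ h _ (hTE h)
  have hxE : ∀ n, x n ∈ E := by
    intro n
    induction n with
    | zero => rw [hx0]; exact hu0
    | succ k ih => rw [hx]; exact hc _ (hα k) _ (hTE ih) _ (hTE (hyE k ih))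
  have hA1 : A < 1 := (hαA 0).trans_lt (hα 0).2
  refine iff_of_true ?_ ?_
  · refine aux_tendsto u p (1 - A * (1 - δ)) (by nlinarith) (by nlinarith) ?_
    intro n
    rw [hu]
    refine (aux_conv _ _ _ _ (hα n).1 (hα n).2).trans ?_
    have h1 := mul_le_mul_of_nonneg_left (hTp _ (huE n)) (hα n).1
    have h2 := mul_le_mul_of_nonneg_right (hαA n)
      (mul_nonneg (sub_nonneg.2 hδ1.le) (norm_nonneg (u n - p)))
    linarith
  · refine aux_tendsto x p δ hδ0 hδ1 ?_
    intro n
    rw [hx]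
    refine (aux_conv _ _ _ _ (hα n).1 (hα n).2).trans ?_
    have hyn : ‖y n - p‖ ≤ ‖x n - p‖ := by
      rw [hy]
      refine (aux_conv _ _ _ _ (hβ n).1 (hβ n).2).trans ?_
      have h0 : ‖T (x n) - p‖ ≤ ‖x n - p‖ :=
        (hTp _ (hxE n)).trans (mul_le_of_le_one_left (norm_nonneg _) hδ1.le)
      have h1 := mul_le_mul_of_nonneg_left h0 (hβ n).1
      linarith
    have h3 := (hTp _ (hyE n (hxE n))).trans (mul_le_mul_of_nonneg_left hyn hδ0)
    have h4 := mul_le_mul_of_nonneg_left h3 (hα n).1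
    have h5 := mul_le_mul_of_nonneg_left (hTp _ (hxE n)) (sub_nonneg.2 (hα n).2.le)
    linarith
end

section
/- Let X be a real Banach space, E a nonempty closed convex subset of X, T : E → E a contractive-like map with constant δ ∈ [0,1) and fixed point p, and fix k ≥ 2. Let (x_n) be the new multistep iteration with auxiliary sequences y_n^1, …, y_n^{k−1}, built from sequences (α_n), (β_n^i) in [0,1). Then for every n and every i ∈ {1,…,k−1}, ‖y_n^i − T y_n^i‖ ≤ (1 + δ)‖x_n − p‖; consequently, if x_n → p then ‖y_n^i − T y_n^i‖ → 0 for each i. -/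
open Filter Topology

theorem stmt9 {X : Type*} [NormedAddCommGroup X] [NormedSpace ℝ X] [CompleteSpace X]
    {E : Set X} (hEne : E.Nonempty) (hEcl : IsClosed E) (hEcv : Convex ℝ E)
    {T : X → X} (hTE : Set.MapsTo T E E)
    {δ : ℝ} (hδ0 : 0 ≤ δ) (hδ1 : δ < 1)
    {φ : ℝ → ℝ} (hφ0 : φ 0 = 0) (hφmono : StrictMonoOn φ (Set.Ici 0))
    (hφcont : ContinuousOn φ (Set.Ici 0)) (hφnonneg : ∀ t, 0 ≤ t → 0 ≤ φ t)
    (hT : ∀ x ∈ E, ∀ y ∈ E, ‖T x - T y‖ ≤ δ * ‖x - y‖ + φ ‖x - T x‖)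
    {p : X} (hpE : p ∈ E) (hfix : T p = p)
    (k : ℕ) (hk : 2 ≤ k)
    (α : ℕ → ℝ) (hα : ∀ n, α n ∈ Set.Ico (0:ℝ) 1)
    (β : ℕ → ℕ → ℝ) (hβ : ∀ n i, 1 ≤ i → i ≤ k - 1 → β n i ∈ Set.Ico (0:ℝ) 1)
    (x : ℕ → X) (y : ℕ → ℕ → X) (hx0 : x 0 ∈ E)
    (hytop : ∀ n, y n (k-1) = (1 - β n (k-1)) • x n + β n (k-1) • T (x n))
    (hyi : ∀ n i, 1 ≤ i → i ≤ k - 2 →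
      y n i = (1 - β n i) • y n (i+1) + β n i • T (y n (i+1)))
    (hx : ∀ n, x (n+1) = (1 - α n) • y n 1 + α n • T (y n 1))
    : (∀ n, ∀ i, 1 ≤ i → i ≤ k - 1 → ‖y n i - T (y n i)‖ ≤ (1 + δ) * ‖x n - p‖) ∧
      (Tendsto x atTop (𝓝 p) → ∀ i, 1 ≤ i → i ≤ k - 1 →
        Tendsto (fun n => ‖y n i - T (y n i)‖) atTop (𝓝 0)) := by
  have hTp : ∀ z ∈ E, ‖T z - p‖ ≤ δ * ‖z - p‖ := by
    intro z hz
    have h := hT p hpE z hz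
    rw [hfix, sub_self, norm_zero, hφ0, add_zero] at h
    rwa [norm_sub_rev (T z), norm_sub_rev z]
  have step : ∀ z ∈ E, ∀ b ∈ Set.Ico (0:ℝ) 1,
      (1 - b) • z + b • T z ∈ E ∧ ‖(1 - b) • z + b • T z - p‖ ≤ ‖z - p‖ := by
    intro z hz b hb
    obtain ⟨hb0, hb1⟩ := hb
    refine ⟨hEcv hz (hTE hz) (by linarith) hb0 (by ring), ?_⟩
    have e : (1 - b) • z + b • T z - p = (1 - b) • (z - p) + b • (T z - p) := by
      module
    have h1 : ‖T z - p‖ ≤ ‖z - p‖ := by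
      have := hTp z hz
      nlinarith [norm_nonneg (z - p)]
    calc _ = ‖(1 - b) • (z - p) + b • (T z - p)‖ := by rw [e]
      _ ≤ ‖(1 - b) • (z - p)‖ + ‖b • (T z - p)‖ := norm_add_le _ _
      _ = (1 - b) * ‖z - p‖ + b * ‖T z - p‖ := by
        rw [norm_smul, norm_smul, Real.norm_of_nonneg hb0,
          Real.norm_of_nonneg (by linarith : 0 ≤ 1 - b)]
      _ ≤ _ := by nlinarith
  have hy : ∀ n, x n ∈ E → ∀ j i, 1 ≤ i → i + j = k - 1 →
      y n i ∈ E ∧ ‖y n i - p‖ ≤ ‖x n - p‖ := by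
    intro n hn j
    induction j with
    | zero =>
      intro i hi hij
      have : i = k - 1 := by omega
      subst this
      rw [hytop]
      exact step _ hn _ (hβ n _ hi le_rfl)
    | succ j ih =>
      intro i hi hij
      obtain ⟨h1, h2⟩ := ih (i + 1) (by omega) (by omega)
      rw [hyi n i hi (by omega)]
      obtain ⟨h3, h4⟩ := step _ h1 _ (hβ n i hi (by omega))
      exact ⟨h3, h4.trans h2⟩
  have hxE : ∀ n, x n ∈ E := by
    intro n
    induction n with
    | zero => exact hx0
    | succ n ih =>
      rw [hx]
      exact (step _ (hy n ih (k - 2) 1 le_rfl (by omega)).1 _ (hα n)).1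
  have main : ∀ n, ∀ i, 1 ≤ i → i ≤ k - 1 →
      ‖y n i - T (y n i)‖ ≤ (1 + δ) * ‖x n - p‖ := by
    intro n i hi hik
    obtain ⟨h1, h2⟩ := hy n (hxE n) (k - 1 - i) i hi (by omega)
    have h3 := hTp _ h1
    have h4 := norm_sub_le_norm_sub_add_norm_sub (y n i) p (T (y n i))
    rw [norm_sub_rev p] at h4
    nlinarith
  refine ⟨main, fun hlim i hi hik => ?_⟩
  have h := (tendsto_iff_norm_sub_tendsto_zero.1 hlim).const_mul (1 + δ)
  rw [mul_zero] at h
  exact squeeze_zero (fun n => norm_nonneg _) (fun n => main n i hi hik) h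
end

section
/- Let X be a real Banach space, E a nonempty closed convex subset of X, and T : E → E a contractive-like map with fixed point p. Let (α_n), (β_n) be sequences in [0,1) with α_n ≥ A > 0 for all n. Let (u_n) be the Mann iteration and (x_n) the Ishikawa iteration, both started at the same point u_0 = x_0 ∈ E. Then u_n → p if and only if x_n → p. -/
open Filter Topology

lemma conv_aux {X : Type*} [NormedAddCommGroup X] [NormedSpace ℝ X]
    {δ A : ℝ} (hδ0 : 0 ≤ δ) (hδ1 : δ < 1) (hA0 : 0 < A) (p : X)
    (α : ℕ → ℝ) (hα : ∀ n, α n ∈ Set.Ico (0:ℝ) 1) (hαA : ∀ n, A ≤ α n)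
    (z w : ℕ → X) (hz : ∀ n, z (n+1) = (1 - α n) • z n + α n • w n)
    (hw : ∀ n, ‖w n - p‖ ≤ δ * ‖z n - p‖) : Tendsto z atTop (𝓝 p) := by
  have hA1 : A < 1 := (hαA 0).trans_lt (hα 0).2
  have hq0 : 0 ≤ 1 - A * (1 - δ) := by nlinarith
  have hq1 : 1 - A * (1 - δ) < 1 := by nlinarith
  have step : ∀ n, ‖z (n+1) - p‖ ≤ (1 - A * (1 - δ)) * ‖z n - p‖ := by
    intro n
    have e : z (n+1) - p = (1 - α n) • (z n - p) + α n • (w n - p) := by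
      rw [hz]; module
    have h0 := (hα n).1
    have h1 := (hα n).2
    have h := norm_add_le ((1 - α n) • (z n - p)) (α n • (w n - p))
    rw [← e, norm_smul, norm_smul, Real.norm_of_nonneg h0,
      Real.norm_of_nonneg (by linarith)] at h
    have h2 := mul_le_mul_of_nonneg_left (hw n) h0
    have h3 : 0 ≤ (α n - A) * ((1 - δ) * ‖z n - p‖) :=
      mul_nonneg (by linarith [hαA n]) (mul_nonneg (by linarith) (norm_nonneg _))
    nlinarith
  have bd : ∀ n, ‖z n - p‖ ≤ (1 - A * (1 - δ)) ^ n * ‖z 0 - p‖ := by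
    intro n
    induction n with
    | zero => simp
    | succ k ih =>
      calc _ ≤ _ := step k
        _ ≤ (1 - A * (1 - δ)) * ((1 - A * (1 - δ)) ^ k * ‖z 0 - p‖) :=
          mul_le_mul_of_nonneg_left ih hq0
        _ = _ := by ring
  rw [tendsto_iff_norm_sub_tendsto_zero]
  refine squeeze_zero (fun n => norm_nonneg _) bd ?_
  simpa using (tendsto_pow_atTop_nhds_zero_of_lt_one hq0 hq1).mul_const ‖z 0 - p‖

theorem stmt11 {X : Type*} [NormedAddCommGroup X] [NormedSpace ℝ X] [CompleteSpace X]
    {E : Set X} (hEne : E.Nonempty) (hEcl : IsClosed E) (hEcv : Convex ℝ E)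
    {T : X → X} (hTE : Set.MapsTo T E E)
    {δ : ℝ} (hδ0 : 0 ≤ δ) (hδ1 : δ < 1)
    {φ : ℝ → ℝ} (hφ0 : φ 0 = 0) (hφmono : StrictMonoOn φ (Set.Ici 0))
    (hφcont : ContinuousOn φ (Set.Ici 0)) (hφnonneg : ∀ t, 0 ≤ t → 0 ≤ φ t)
    (hT : ∀ x ∈ E, ∀ y ∈ E, ‖T x - T y‖ ≤ δ * ‖x - y‖ + φ ‖x - T x‖)
    {p : X} (hpE : p ∈ E) (hfix : T p = p)
    (α : ℕ → ℝ) (hα : ∀ n, α n ∈ Set.Ico (0:ℝ) 1)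
    {A : ℝ} (hA0 : 0 < A) (hαA : ∀ n, A ≤ α n)
    (u : ℕ → X) (hu0 : u 0 ∈ E)
    (hu : ∀ n, u (n+1) = (1 - α n) • u n + α n • T (u n))
    (β : ℕ → ℝ) (hβ : ∀ n, β n ∈ Set.Ico (0:ℝ) 1)
    (x y : ℕ → X) (hx0 : x 0 = u 0)
    (hy : ∀ n, y n = (1 - β n) • x n + β n • T (x n))
    (hx : ∀ n, x (n+1) = (1 - α n) • x n + α n • T (y n))
    : Tendsto u atTop (𝓝 p) ↔ Tendsto x atTop (𝓝 p) := by
  have key : ∀ z ∈ E, ‖T z - p‖ ≤ δ * ‖z - p‖ := by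
    intro z hz
    have h := hT p hpE z hz
    rw [hfix, sub_self, norm_zero, hφ0, add_zero] at h
    rwa [norm_sub_rev, norm_sub_rev z p]
  have cv : ∀ a ∈ Set.Ico (0:ℝ) 1, ∀ v ∈ E, ∀ w ∈ E, (1 - a) • v + a • w ∈ E :=
    fun a ha v hv w hw => hEcv hv hw (by linarith [ha.2]) ha.1 (by ring)
  have huE : ∀ n, u n ∈ E := by
    intro n
    induction n with
    | zero => exact hu0
    | succ k ih => rw [hu]; exact cv _ (hα k) _ ih _ (hTE ih)
  have hyE' : ∀ n, x n ∈ E → y n ∈ E := by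
    intro n h
    rw [hy]; exact cv _ (hβ n) _ h _ (hTE h)
  have hxE : ∀ n, x n ∈ E := by
    intro n
    induction n with
    | zero => rw [hx0]; exact hu0
    | succ k ih => rw [hx]; exact cv _ (hα k) _ ih _ (hTE (hyE' k ih))
  have hyle : ∀ n, ‖y n - p‖ ≤ ‖x n - p‖ := by
    intro n
    have e : y n - p = (1 - β n) • (x n - p) + β n • (T (x n) - p) := by
      rw [hy]; module
    have h0 := (hβ n).1
    have h1 := (hβ n).2
    have h := norm_add_le ((1 - β n) • (x n - p)) (β n • (T (x n) - p))
    rw [← e, norm_smul, norm_smul, Real.norm_of_nonneg h0,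
      Real.norm_of_nonneg (by linarith)] at h
    have h2 := mul_le_mul_of_nonneg_left (key _ (hxE n)) h0
    have h3 : 0 ≤ β n * ((1 - δ) * ‖x n - p‖) :=
      mul_nonneg h0 (mul_nonneg (by linarith) (norm_nonneg _))
    nlinarith
  refine iff_of_true ?_ ?_
  · exact conv_aux hδ0 hδ1 hA0 p α hα hαA u (fun n => T (u n)) hu (fun n => key _ (huE n))
  · exact conv_aux hδ0 hδ1 hA0 p α hα hαA x (fun n => T (y n)) hx
      (fun n => (key _ (hyE' n (hxE n))).trans (mul_le_mul_of_nonneg_left (hyle n) hδ0))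
end

section
/- Let X be a real Banach space, E a nonempty closed convex subset of X, and T : E → E a contractive-like map with fixed point p. Let (α_n) be a sequence in [0,1) with α_n ≥ A > 0 for all n. Let (u_n) be the Mann iteration and (x_n) the Picard iteration x_{n+1} = T x_n, both started at the same point u_0 = x_0 ∈ E. Then u_n → p if and only if x_n → p. -/
open Filter Topology

theorem tendsto_of_geom {X : Type*} [NormedAddCommGroup X] (v : ℕ → X) (p : X) (q : ℝ)
    (h0 : 0 ≤ q) (h1 : q < 1) (h : ∀ n, ‖v (n+1) - p‖ ≤ q * ‖v n - p‖) :
    Tendsto v atTop (𝓝 p) := by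
  have hb : ∀ n, ‖v n - p‖ ≤ q ^ n * ‖v 0 - p‖ := by
    intro n
    induction n with
    | zero => simp
    | succ k ih =>
      calc ‖v (k+1) - p‖ ≤ q * ‖v k - p‖ := h k
        _ ≤ q * (q ^ k * ‖v 0 - p‖) := mul_le_mul_of_nonneg_left ih h0
        _ = q ^ (k+1) * ‖v 0 - p‖ := by ring
  rw [tendsto_iff_norm_sub_tendsto_zero]
  refine squeeze_zero (fun n => norm_nonneg _) hb ?_
  simpa using (tendsto_pow_atTop_nhds_zero_of_lt_one h0 h1).mul_const ‖v 0 - p‖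

theorem stmt12 {X : Type*} [NormedAddCommGroup X] [NormedSpace ℝ X] [CompleteSpace X]
    {E : Set X} (hEne : E.Nonempty) (hEcl : IsClosed E) (hEcv : Convex ℝ E)
    {T : X → X} (hTE : Set.MapsTo T E E)
    {δ : ℝ} (hδ0 : 0 ≤ δ) (hδ1 : δ < 1)
    {φ : ℝ → ℝ} (hφ0 : φ 0 = 0) (hφmono : StrictMonoOn φ (Set.Ici 0))
    (hφcont : ContinuousOn φ (Set.Ici 0)) (hφnonneg : ∀ t, 0 ≤ t → 0 ≤ φ t)
    (hT : ∀ x ∈ E, ∀ y ∈ E, ‖T x - T y‖ ≤ δ * ‖x - y‖ + φ ‖x - T x‖)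
    {p : X} (hpE : p ∈ E) (hfix : T p = p)
    (α : ℕ → ℝ) (hα : ∀ n, α n ∈ Set.Ico (0:ℝ) 1)
    {A : ℝ} (hA0 : 0 < A) (hαA : ∀ n, A ≤ α n)
    (u : ℕ → X) (hu0 : u 0 ∈ E)
    (hu : ∀ n, u (n+1) = (1 - α n) • u n + α n • T (u n))
    (x : ℕ → X) (hx0 : x 0 = u 0)
    (hx : ∀ n, x (n+1) = T (x n))
    : Tendsto u atTop (𝓝 p) ↔ Tendsto x atTop (𝓝 p) := by
  have hc : ∀ y ∈ E, ‖T y - p‖ ≤ δ * ‖y - p‖ := by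
    intro y hy
    have := hT p hpE y hy
    simp only [hfix, sub_self, norm_zero, hφ0, add_zero] at this
    rwa [norm_sub_rev, norm_sub_rev y p]
  have hxE : ∀ n, x n ∈ E := by
    intro n
    induction n with
    | zero => rw [hx0]; exact hu0
    | succ k ih => rw [hx]; exact hTE ih
  have huE : ∀ n, u n ∈ E := by
    intro n
    induction n with
    | zero => exact hu0
    | succ k ih =>
      rw [hu]
      exact hEcv ih (hTE ih) (by linarith [(hα k).2]) (hα k).1 (by ring)
  have hxt : Tendsto x atTop (𝓝 p) :=
    tendsto_of_geom x p δ hδ0 hδ1 (fun n => by rw [hx]; exact hc _ (hxE n))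
  have hA1 : A < 1 := lt_of_le_of_lt (hαA 0) (hα 0).2
  have hut : Tendsto u atTop (𝓝 p) := by
    refine tendsto_of_geom u p (1 - A * (1 - δ)) (by nlinarith) (by nlinarith) (fun n => ?_)
    have h1 : 0 ≤ 1 - α n := by linarith [(hα n).2]
    have h2 := (hα n).1
    have e : u (n+1) - p = (1 - α n) • (u n - p) + α n • (T (u n) - p) := by
      rw [hu]; module
    have h3 := mul_le_mul_of_nonneg_left (hc _ (huE n)) h2
    have h4 : 0 ≤ (α n - A) * ((1 - δ) * ‖u n - p‖) :=
      mul_nonneg (by linarith [hαA n]) (mul_nonneg (by linarith) (norm_nonneg _))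
    calc ‖u (n+1) - p‖ ≤ ‖(1 - α n) • (u n - p)‖ + ‖α n • (T (u n) - p)‖ := by
          rw [e]; exact norm_add_le _ _
      _ = (1 - α n) * ‖u n - p‖ + α n * ‖T (u n) - p‖ := by
          rw [norm_smul, norm_smul, Real.norm_of_nonneg h1, Real.norm_of_nonneg h2]
      _ ≤ (1 - A * (1 - δ)) * ‖u n - p‖ := by linarith
  exact ⟨fun _ => hxt, fun _ => hut⟩
end

section
/- Let X be a real Banach space, E a nonempty closed convex subset of X, and T : E → E a contractive-like map with fixed point p. Let (α_n) be a sequence in [0,1) with α_n ≥ A > 0 for all n, and let λ ∈ (0,1) be a constant. Let (u_n) be the Mann iteration and (x_n) the Krasnoselskij iteration x_{n+1} = (1 − λ)x_n + λ T x_n, both started at the same point u_0 = x_0 ∈ E. Then u_n → p if and only if x_n → p. -/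
open Filter Topology

/-- Mann iterations of a quasi-contraction with step sizes bounded below converge. -/
theorem mann_tendsto {X : Type*} [NormedAddCommGroup X] [NormedSpace ℝ X]
    {E : Set X} (hEcv : Convex ℝ E) {T : X → X} (hTE : Set.MapsTo T E E)
    {δ : ℝ} (hδ1 : δ < 1) {p : X}
    (hT : ∀ y ∈ E, ‖T y - p‖ ≤ δ * ‖y - p‖)
    (α : ℕ → ℝ) (hα : ∀ n, α n ∈ Set.Ico (0:ℝ) 1)
    {A : ℝ} (hA0 : 0 < A) (hδ0 : 0 ≤ δ) (hαA : ∀ n, A ≤ α n)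
    (u : ℕ → X) (hu0 : u 0 ∈ E)
    (hu : ∀ n, u (n+1) = (1 - α n) • u n + α n • T (u n)) :
    Tendsto u atTop (𝓝 p) := by
  have hE : ∀ n, u n ∈ E := by
    intro n
    induction n with
    | zero => exact hu0
    | succ k ih =>
      rw [hu]
      exact hEcv ih (hTE ih) (by linarith [(hα k).2]) (hα k).1 (by ring)
  have hA1 : A < 1 := lt_of_le_of_lt (hαA 0) (hα 0).2
  have hr0 : 0 ≤ 1 - A * (1 - δ) := by nlinarith
  have hr1 : 1 - A * (1 - δ) < 1 := by nlinarith
  have step : ∀ n, ‖u (n+1) - p‖ ≤ (1 - A * (1 - δ)) * ‖u n - p‖ := by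
    intro n
    have e : u (n+1) - p = (1 - α n) • (u n - p) + α n • (T (u n) - p) := by
      rw [hu]; module
    have h1 : 0 ≤ 1 - α n := by linarith [(hα n).2]
    have h0 := (hα n).1
    have h2 := mul_le_mul_of_nonneg_left (hT _ (hE n)) h0
    have h3 : 0 ≤ (α n - A) * ((1 - δ) * ‖u n - p‖) :=
      mul_nonneg (by linarith [hαA n]) (mul_nonneg (by linarith) (norm_nonneg _))
    calc ‖u (n+1) - p‖ ≤ ‖(1 - α n) • (u n - p)‖ + ‖α n • (T (u n) - p)‖ := by
          rw [e]; exact norm_add_le _ _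
      _ = (1 - α n) * ‖u n - p‖ + α n * ‖T (u n) - p‖ := by
          rw [norm_smul, norm_smul, Real.norm_of_nonneg h1, Real.norm_of_nonneg h0]
      _ ≤ _ := by nlinarith
  have bound : ∀ n, ‖u n - p‖ ≤ (1 - A * (1 - δ)) ^ n * ‖u 0 - p‖ := by
    intro n
    induction n with
    | zero => simp
    | succ k ih =>
      refine (step k).trans ?_
      rw [pow_succ', mul_assoc]
      exact mul_le_mul_of_nonneg_left ih hr0
  rw [tendsto_iff_norm_sub_tendsto_zero]
  refine squeeze_zero (fun _ => norm_nonneg _) bound ?_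
  simpa using (tendsto_pow_atTop_nhds_zero_of_lt_one hr0 hr1).mul_const ‖u 0 - p‖

theorem stmt13 {X : Type*} [NormedAddCommGroup X] [NormedSpace ℝ X] [CompleteSpace X]
    {E : Set X} (hEne : E.Nonempty) (hEcl : IsClosed E) (hEcv : Convex ℝ E)
    {T : X → X} (hTE : Set.MapsTo T E E)
    {δ : ℝ} (hδ0 : 0 ≤ δ) (hδ1 : δ < 1)
    {φ : ℝ → ℝ} (hφ0 : φ 0 = 0) (hφmono : StrictMonoOn φ (Set.Ici 0))
    (hφcont : ContinuousOn φ (Set.Ici 0)) (hφnonneg : ∀ t, 0 ≤ t → 0 ≤ φ t)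
    (hT : ∀ x ∈ E, ∀ y ∈ E, ‖T x - T y‖ ≤ δ * ‖x - y‖ + φ ‖x - T x‖)
    {p : X} (hpE : p ∈ E) (hfix : T p = p)
    (α : ℕ → ℝ) (hα : ∀ n, α n ∈ Set.Ico (0:ℝ) 1)
    {A : ℝ} (hA0 : 0 < A) (hαA : ∀ n, A ≤ α n)
    (u : ℕ → X) (hu0 : u 0 ∈ E)
    (hu : ∀ n, u (n+1) = (1 - α n) • u n + α n • T (u n))
    (lam : ℝ) (hlam : lam ∈ Set.Ioo (0:ℝ) 1)
    (x : ℕ → X) (hx0 : x 0 = u 0)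
    (hx : ∀ n, x (n+1) = (1 - lam) • x n + lam • T (x n))
    : Tendsto u atTop (𝓝 p) ↔ Tendsto x atTop (𝓝 p) := by
  have hq : ∀ y ∈ E, ‖T y - p‖ ≤ δ * ‖y - p‖ := by
    intro y hy
    have h := hT p hpE y hy
    rw [hfix, sub_self, norm_zero, hφ0, add_zero, norm_sub_rev p, norm_sub_rev p] at h
    exact h
  refine iff_of_true (mann_tendsto hEcv hTE hδ1 hq α hα hA0 hδ0 hαA u hu0 hu) ?_
  exact mann_tendsto hEcv hTE hδ1 hq (fun _ => lam) (fun _ => ⟨hlam.1.le, hlam.2⟩) hlam.1 hδ0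
    (fun _ => le_rfl) x (hx0 ▸ hu0) hx
end

section
/- Let X be a real Banach space, E a nonempty closed convex subset of X, and T : E → E a contractive-like map with fixed point p. Let (α_n), (β_n) be sequences in [0,1) with α_n ≥ A > 0 for all n. Let (u_n) be the Mann iteration and (x_n) the new two-step iteration, both started at the same point u_0 = x_0 ∈ E. Then u_n → p if and only if x_n → p. -/
open Filter Topology

theorem stmt14 {X : Type*} [NormedAddCommGroup X] [NormedSpace ℝ X] [CompleteSpace X]
    {E : Set X} (hEne : E.Nonempty) (hEcl : IsClosed E) (hEcv : Convex ℝ E)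
    {T : X → X} (hTE : Set.MapsTo T E E)
    {δ : ℝ} (hδ0 : 0 ≤ δ) (hδ1 : δ < 1)
    {φ : ℝ → ℝ} (hφ0 : φ 0 = 0) (hφmono : StrictMonoOn φ (Set.Ici 0))
    (hφcont : ContinuousOn φ (Set.Ici 0)) (hφnonneg : ∀ t, 0 ≤ t → 0 ≤ φ t)
    (hT : ∀ x ∈ E, ∀ y ∈ E, ‖T x - T y‖ ≤ δ * ‖x - y‖ + φ ‖x - T x‖)
    {p : X} (hpE : p ∈ E) (hfix : T p = p)
    (α : ℕ → ℝ) (hα : ∀ n, α n ∈ Set.Ico (0:ℝ) 1)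
    {A : ℝ} (hA0 : 0 < A) (hαA : ∀ n, A ≤ α n)
    (u : ℕ → X) (hu0 : u 0 ∈ E)
    (hu : ∀ n, u (n+1) = (1 - α n) • u n + α n • T (u n))
    (β : ℕ → ℝ) (hβ : ∀ n, β n ∈ Set.Ico (0:ℝ) 1)
    (x y : ℕ → X) (hx0 : x 0 = u 0)
    (hy : ∀ n, y n = (1 - β n) • x n + β n • T (x n))
    (hx : ∀ n, x (n+1) = (1 - α n) • y n + α n • T (y n))
    : Tendsto u atTop (𝓝 p) ↔ Tendsto x atTop (𝓝 p) := by
  have key : ∀ z ∈ E, ‖T z - p‖ ≤ δ * ‖z - p‖ := by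
    intro z hz
    have h := hT p hpE z hz
    rw [hfix, sub_self, norm_zero, hφ0, add_zero, norm_sub_rev p (T z), norm_sub_rev p z] at h
    exact h
  have mem : ∀ z ∈ E, ∀ a ∈ Set.Ico (0:ℝ) 1, (1 - a) • z + a • T z ∈ E := by
    intro z hz a ha
    exact hEcv hz (hTE hz) (by linarith [ha.2]) ha.1 (by ring)
  have step : ∀ z ∈ E, ∀ a ∈ Set.Ico (0:ℝ) 1,
      ‖(1 - a) • z + a • T z - p‖ ≤ (1 - a * (1 - δ)) * ‖z - p‖ := by
    intro z hz a ha
    have e : (1 - a) • z + a • T z - p = (1 - a) • (z - p) + a • (T z - p) := by module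
    rw [e]
    refine (norm_add_le _ _).trans ?_
    rw [norm_smul, norm_smul, Real.norm_of_nonneg ha.1,
      Real.norm_of_nonneg (by linarith [ha.2] : (0:ℝ) ≤ 1 - a)]
    have := mul_le_mul_of_nonneg_left (key z hz) ha.1
    linarith
  have hd : 0 < 1 - δ := by linarith
  have hq1 : 1 - A * (1 - δ) < 1 := by nlinarith
  have hA1 : A < 1 := (hαA 0).trans_lt (hα 0).2
  have hq0 : 0 ≤ 1 - A * (1 - δ) := by nlinarith
  have stepA : ∀ z ∈ E, ∀ n, ‖(1 - α n) • z + α n • T z - p‖ ≤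
      (1 - A * (1 - δ)) * ‖z - p‖ := by
    intro z hz n
    refine (step z hz _ (hα n)).trans (mul_le_mul_of_nonneg_right ?_ (norm_nonneg _))
    linarith [mul_le_mul_of_nonneg_right (hαA n) hd.le]
  have conv : ∀ w : ℕ → X, (∀ n, ‖w (n+1) - p‖ ≤ (1 - A * (1 - δ)) * ‖w n - p‖) →
      Tendsto w atTop (𝓝 p) := by
    intro w hw
    have hb : ∀ n, ‖w n - p‖ ≤ (1 - A * (1 - δ)) ^ n * ‖w 0 - p‖ := by
      intro n
      induction n with
      | zero => simp
      | succ k ih =>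
        refine (hw k).trans ((mul_le_mul_of_nonneg_left ih hq0).trans (le_of_eq ?_))
        ring
    rw [tendsto_iff_norm_sub_tendsto_zero]
    refine squeeze_zero (fun _ => norm_nonneg _) hb ?_
    simpa using (tendsto_pow_atTop_nhds_zero_of_lt_one hq0 hq1).mul_const ‖w 0 - p‖
  have huE : ∀ n, u n ∈ E := by
    intro n
    induction n with
    | zero => exact hu0
    | succ k ih => rw [hu]; exact mem _ ih _ (hα k)
  have hyE : ∀ n, x n ∈ E → y n ∈ E := by
    intro n h
    rw [hy]
    exact mem _ h _ (hβ n)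
  have hxE : ∀ n, x n ∈ E := by
    intro n
    induction n with
    | zero => rw [hx0]; exact hu0
    | succ k ih => rw [hx]; exact mem _ (hyE k ih) _ (hα k)
  have h1 : Tendsto u atTop (𝓝 p) := conv u (fun n => by
    rw [hu]; exact stepA _ (huE n) n)
  have h2 : Tendsto x atTop (𝓝 p) := conv x (fun n => by
    rw [hx]
    refine (stepA _ (hyE n (hxE n)) n).trans (mul_le_mul_of_nonneg_left ?_ hq0)
    rw [hy]
    refine (step _ (hxE n) _ (hβ n)).trans ?_
    have h3 := mul_nonneg (mul_nonneg (hβ n).1 hd.le) (norm_nonneg (x n - p))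
    linarith)
  exact ⟨fun _ => h2, fun _ => h1⟩
end

section
/- Let X be a real Banach space, E a nonempty closed convex subset of X, and T : E → E a contractive-like map with fixed point p. Let (α_n), (β_n), (γ_n) be sequences in [0,1) with α_n ≥ A > 0 for all n. Let (u_n) be the Mann iteration and (x_n) the Noor iteration, both started at the same point u_0 = x_0 ∈ E. Then u_n → p if and only if x_n → p. -/
open Filter Topology

theorem aux_comb {X : Type*} [NormedAddCommGroup X] [NormedSpace ℝ X] (p w v : X) (a d : ℝ)
    (ha : a ∈ Set.Ico (0:ℝ) 1) (hv : ‖v - p‖ ≤ d * ‖w - p‖) :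
    ‖((1 - a) • w + a • v) - p‖ ≤ (1 - a * (1 - d)) * ‖w - p‖ := by
  have h : ((1 - a) • w + a • v) - p = (1 - a) • (w - p) + a • (v - p) := by module
  rw [h]
  have h1 := norm_add_le ((1 - a) • (w - p)) (a • (v - p))
  rw [norm_smul, norm_smul, Real.norm_of_nonneg ha.1,
    Real.norm_of_nonneg (by linarith [ha.2] : 0 ≤ 1 - a)] at h1
  have h2 := mul_le_mul_of_nonneg_left hv ha.1
  linarith

theorem aux_tendsto_s15 {X : Type*} [NormedAddCommGroup X] [NormedSpace ℝ X] (p : X)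
    (w v : ℕ → X) (α : ℕ → ℝ) (hα : ∀ n, α n ∈ Set.Ico (0:ℝ) 1) {A δ : ℝ}
    (hδ0 : 0 ≤ δ) (hδ1 : δ < 1) (hA0 : 0 < A) (hαA : ∀ n, A ≤ α n)
    (hw : ∀ n, w (n+1) = (1 - α n) • w n + α n • v n)
    (hv : ∀ n, ‖v n - p‖ ≤ δ * ‖w n - p‖) : Tendsto w atTop (𝓝 p) := by
  have hA1 : A < 1 := (hαA 0).trans_lt (hα 0).2
  have hk0 : 0 ≤ 1 - A * (1 - δ) := by nlinarith
  have hk1 : 1 - A * (1 - δ) < 1 := by nlinarith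
  have hb : ∀ n, ‖w n - p‖ ≤ (1 - A * (1 - δ)) ^ n * ‖w 0 - p‖ := by
    intro n
    induction n with
    | zero => simp
    | succ n ih =>
      have h1 := aux_comb p (w n) (v n) (α n) δ (hα n) (hv n)
      rw [← hw n] at h1
      have h2 : (1 - α n * (1 - δ)) * ‖w n - p‖ ≤ (1 - A * (1 - δ)) * ‖w n - p‖ := by
        apply mul_le_mul_of_nonneg_right _ (norm_nonneg _)
        nlinarith [hαA n]
      have h3 := mul_le_mul_of_nonneg_left ih hk0
      rw [pow_succ]
      linarith
  rw [tendsto_iff_norm_sub_tendsto_zero]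
  refine squeeze_zero (fun n => norm_nonneg _) hb ?_
  simpa using (tendsto_pow_atTop_nhds_zero_of_lt_one hk0 hk1).mul_const ‖w 0 - p‖

theorem stmt15 {X : Type*} [NormedAddCommGroup X] [NormedSpace ℝ X] [CompleteSpace X]
    {E : Set X} (hEne : E.Nonempty) (hEcl : IsClosed E) (hEcv : Convex ℝ E)
    {T : X → X} (hTE : Set.MapsTo T E E)
    {δ : ℝ} (hδ0 : 0 ≤ δ) (hδ1 : δ < 1)
    {φ : ℝ → ℝ} (hφ0 : φ 0 = 0) (hφmono : StrictMonoOn φ (Set.Ici 0))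
    (hφcont : ContinuousOn φ (Set.Ici 0)) (hφnonneg : ∀ t, 0 ≤ t → 0 ≤ φ t)
    (hT : ∀ x ∈ E, ∀ y ∈ E, ‖T x - T y‖ ≤ δ * ‖x - y‖ + φ ‖x - T x‖)
    {p : X} (hpE : p ∈ E) (hfix : T p = p)
    (α : ℕ → ℝ) (hα : ∀ n, α n ∈ Set.Ico (0:ℝ) 1)
    {A : ℝ} (hA0 : 0 < A) (hαA : ∀ n, A ≤ α n)
    (u : ℕ → X) (hu0 : u 0 ∈ E)
    (hu : ∀ n, u (n+1) = (1 - α n) • u n + α n • T (u n))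
    (β γ : ℕ → ℝ) (hβ : ∀ n, β n ∈ Set.Ico (0:ℝ) 1) (hγ : ∀ n, γ n ∈ Set.Ico (0:ℝ) 1)
    (x y z : ℕ → X) (hx0 : x 0 = u 0)
    (hz : ∀ n, z n = (1 - γ n) • x n + γ n • T (x n))
    (hy : ∀ n, y n = (1 - β n) • x n + β n • T (z n))
    (hx : ∀ n, x (n+1) = (1 - α n) • x n + α n • T (y n))
    : Tendsto u atTop (𝓝 p) ↔ Tendsto x atTop (𝓝 p) := by
  have hTp : ∀ w ∈ E, ‖T w - p‖ ≤ δ * ‖w - p‖ := by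
    intro w hw
    have h := hT p hpE w hw
    rw [hfix, sub_self, norm_zero, hφ0, add_zero] at h
    rwa [norm_sub_rev, norm_sub_rev w p]
  have hcomb : ∀ a ∈ Set.Ico (0:ℝ) 1, ∀ w ∈ E, ∀ v ∈ E, (1 - a) • w + a • v ∈ E := by
    intro a ha w hw v hv
    exact hEcv hw hv (by linarith [ha.2]) ha.1 (by ring)
  have huE : ∀ n, u n ∈ E := by
    intro n
    induction n with
    | zero => exact hu0
    | succ n ih => rw [hu]; exact hcomb _ (hα n) _ ih _ (hTE ih)
  have hzE : ∀ n, x n ∈ E → z n ∈ E := by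
    intro n h; rw [hz]; exact hcomb _ (hγ n) _ h _ (hTE h)
  have hyE : ∀ n, x n ∈ E → y n ∈ E := by
    intro n h; rw [hy]; exact hcomb _ (hβ n) _ h _ (hTE (hzE n h))
  have hxE : ∀ n, x n ∈ E := by
    intro n
    induction n with
    | zero => rw [hx0]; exact hu0
    | succ n ih => rw [hx]; exact hcomb _ (hα n) _ ih _ (hTE (hyE n ih))
  have key : ∀ a ∈ Set.Ico (0:ℝ) 1, ∀ w v : X, ‖v - p‖ ≤ δ * ‖w - p‖ →
      ‖((1 - a) • w + a • v) - p‖ ≤ ‖w - p‖ := by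
    intro a ha w v hv
    refine (aux_comb p w v a δ ha hv).trans ?_
    have : 0 ≤ a * (1 - δ) := mul_nonneg ha.1 (by linarith)
    nlinarith [mul_nonneg this (norm_nonneg (w - p))]
  refine iff_of_true ?_ ?_
  · exact aux_tendsto_s15 p u (fun n => T (u n)) α hα hδ0 hδ1 hA0 hαA hu
      (fun n => hTp _ (huE n))
  · refine aux_tendsto_s15 p x (fun n => T (y n)) α hα hδ0 hδ1 hA0 hαA hx (fun n => ?_)
    have h1 : ‖z n - p‖ ≤ ‖x n - p‖ := by
      rw [hz]; exact key _ (hγ n) _ _ (hTp _ (hxE n))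
    have h2 : ‖y n - p‖ ≤ ‖x n - p‖ := by
      rw [hy]
      exact key _ (hβ n) _ _ ((hTp _ (hzE n (hxE n))).trans
        (mul_le_mul_of_nonneg_left h1 hδ0))
    exact (hTp _ (hyE n (hxE n))).trans (mul_le_mul_of_nonneg_left h2 hδ0)
end

section
/- Let X be a real Banach space, E a nonempty closed convex subset of X, and T : E → E a contractive-like map with fixed point p. Let (α_n), (β_n), (γ_n) be sequences in [0,1) with α_n ≥ A > 0 for all n. Let (u_n) be the Mann iteration and (x_n) the SP iteration, both started at the same point u_0 = x_0 ∈ E. Then u_n → p if and only if x_n → p. -/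
open Filter Topology

theorem stmt16 {X : Type*} [NormedAddCommGroup X] [NormedSpace ℝ X] [CompleteSpace X]
    {E : Set X} (hEne : E.Nonempty) (hEcl : IsClosed E) (hEcv : Convex ℝ E)
    {T : X → X} (hTE : Set.MapsTo T E E)
    {δ : ℝ} (hδ0 : 0 ≤ δ) (hδ1 : δ < 1)
    {φ : ℝ → ℝ} (hφ0 : φ 0 = 0) (hφmono : StrictMonoOn φ (Set.Ici 0))
    (hφcont : ContinuousOn φ (Set.Ici 0)) (hφnonneg : ∀ t, 0 ≤ t → 0 ≤ φ t)
    (hT : ∀ x ∈ E, ∀ y ∈ E, ‖T x - T y‖ ≤ δ * ‖x - y‖ + φ ‖x - T x‖)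
    {p : X} (hpE : p ∈ E) (hfix : T p = p)
    (α : ℕ → ℝ) (hα : ∀ n, α n ∈ Set.Ico (0:ℝ) 1)
    {A : ℝ} (hA0 : 0 < A) (hαA : ∀ n, A ≤ α n)
    (u : ℕ → X) (hu0 : u 0 ∈ E)
    (hu : ∀ n, u (n+1) = (1 - α n) • u n + α n • T (u n))
    (β γ : ℕ → ℝ) (hβ : ∀ n, β n ∈ Set.Ico (0:ℝ) 1) (hγ : ∀ n, γ n ∈ Set.Ico (0:ℝ) 1)
    (x y z : ℕ → X) (hx0 : x 0 = u 0)
    (hz : ∀ n, z n = (1 - γ n) • x n + γ n • T (x n))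
    (hy : ∀ n, y n = (1 - β n) • z n + β n • T (z n))
    (hx : ∀ n, x (n+1) = (1 - α n) • y n + α n • T (y n))
    : Tendsto u atTop (𝓝 p) ↔ Tendsto x atTop (𝓝 p) := by
  have hTp : ∀ v ∈ E, ‖T v - p‖ ≤ δ * ‖v - p‖ := by
    intro v hv
    have h := hT p hpE v hv
    rw [hfix, sub_self, norm_zero, hφ0, add_zero, norm_sub_rev p, norm_sub_rev p] at h
    exact h
  have hmem : ∀ a ∈ Set.Ico (0:ℝ) 1, ∀ v ∈ E, (1 - a) • v + a • T v ∈ E := by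
    intro a ha v hv
    exact hEcv hv (hTE hv) (by linarith [ha.2]) ha.1 (by ring)
  have hstep : ∀ a ∈ Set.Ico (0:ℝ) 1, ∀ v ∈ E,
      ‖((1 - a) • v + a • T v) - p‖ ≤ (1 - a * (1 - δ)) * ‖v - p‖ := by
    intro a ha v hv
    have e : ((1 - a) • v + a • T v) - p = (1 - a) • (v - p) + a • (T v - p) := by module
    have h1 : 0 ≤ 1 - a := by linarith [ha.2]
    rw [e]
    refine (norm_add_le _ _).trans ?_
    rw [norm_smul, norm_smul, Real.norm_of_nonneg h1, Real.norm_of_nonneg ha.1]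
    have := mul_le_mul_of_nonneg_left (hTp v hv) ha.1
    linarith
  have hstep1 : ∀ a ∈ Set.Ico (0:ℝ) 1, ∀ v ∈ E,
      ‖((1 - a) • v + a • T v) - p‖ ≤ ‖v - p‖ := by
    intro a ha v hv
    refine (hstep a ha v hv).trans (mul_le_of_le_one_left (norm_nonneg _) ?_)
    have := mul_nonneg ha.1 (sub_nonneg.2 hδ1.le)
    linarith
  have hstepA : ∀ n, ∀ v ∈ E,
      ‖((1 - α n) • v + α n • T v) - p‖ ≤ (1 - A * (1 - δ)) * ‖v - p‖ := by
    intro n v hv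
    refine (hstep _ (hα n) v hv).trans (mul_le_mul_of_nonneg_right ?_ (norm_nonneg _))
    have := mul_le_mul_of_nonneg_right (hαA n) (sub_nonneg.2 hδ1.le)
    linarith
  have hA1 : A < 1 := (hαA 0).trans_lt (hα 0).2
  have hr0 : 0 ≤ 1 - A * (1 - δ) := by nlinarith
  have hr1 : 1 - A * (1 - δ) < 1 := by nlinarith
  have key : ∀ w : ℕ → X,
      (∀ n, ‖w (n+1) - p‖ ≤ (1 - A * (1 - δ)) * ‖w n - p‖) → Tendsto w atTop (𝓝 p) := by
    intro w hw
    have hb : ∀ n, ‖w n - p‖ ≤ (1 - A * (1 - δ)) ^ n * ‖w 0 - p‖ := by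
      intro n
      induction n with
      | zero => simp
      | succ k ih =>
        refine (hw k).trans ((mul_le_mul_of_nonneg_left ih hr0).trans (le_of_eq ?_))
        ring
    rw [tendsto_iff_norm_sub_tendsto_zero]
    refine squeeze_zero (fun n => norm_nonneg _) hb ?_
    simpa using (tendsto_pow_atTop_nhds_zero_of_lt_one hr0 hr1).mul_const ‖w 0 - p‖
  have huE : ∀ n, u n ∈ E := by
    intro n
    induction n with
    | zero => exact hu0
    | succ k ih => rw [hu]; exact hmem _ (hα k) _ ih
  have hzE : ∀ n, x n ∈ E → z n ∈ E := by
    intro n h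
    rw [hz]; exact hmem _ (hγ n) _ h
  have hyE : ∀ n, x n ∈ E → y n ∈ E := by
    intro n h
    rw [hy]; exact hmem _ (hβ n) _ (hzE n h)
  have hxE : ∀ n, x n ∈ E := by
    intro n
    induction n with
    | zero => rw [hx0]; exact hu0
    | succ k ih => rw [hx]; exact hmem _ (hα k) _ (hyE k ih)
  refine iff_of_true (key u fun n => ?_) (key x fun n => ?_)
  · rw [hu]; exact hstepA n _ (huE n)
  · have h1 : ‖z n - p‖ ≤ ‖x n - p‖ := by
      rw [hz]; exact hstep1 _ (hγ n) _ (hxE n)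
    have h2 : ‖y n - p‖ ≤ ‖z n - p‖ := by
      rw [hy]; exact hstep1 _ (hβ n) _ (hzE n (hxE n))
    rw [hx]
    exact (hstepA n _ (hyE n (hxE n))).trans (mul_le_mul_of_nonneg_left (h2.trans h1) hr0)
end

section
/- Let X be a real Banach space, E a nonempty closed convex subset of X, T : E → E a contractive-like map with fixed point p, and fix k ≥ 2. Let (α_n) and (β_n^i), i = 1,…,k−1, be sequences in [0,1) with α_n ≥ A > 0 for all n. Let (u_n) be the Mann iteration and (x_n) the multistep iteration, both started at the same point u_0 = x_0 ∈ E. Then u_n → p if and only if x_n → p. -/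
open Filter Topology

theorem stmt17 {X : Type*} [NormedAddCommGroup X] [NormedSpace ℝ X] [CompleteSpace X]
    {E : Set X} (hEne : E.Nonempty) (hEcl : IsClosed E) (hEcv : Convex ℝ E)
    {T : X → X} (hTE : Set.MapsTo T E E)
    {δ : ℝ} (hδ0 : 0 ≤ δ) (hδ1 : δ < 1)
    {φ : ℝ → ℝ} (hφ0 : φ 0 = 0) (hφmono : StrictMonoOn φ (Set.Ici 0))
    (hφcont : ContinuousOn φ (Set.Ici 0)) (hφnonneg : ∀ t, 0 ≤ t → 0 ≤ φ t)
    (hT : ∀ x ∈ E, ∀ y ∈ E, ‖T x - T y‖ ≤ δ * ‖x - y‖ + φ ‖x - T x‖)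
    {p : X} (hpE : p ∈ E) (hfix : T p = p)
    (α : ℕ → ℝ) (hα : ∀ n, α n ∈ Set.Ico (0:ℝ) 1)
    {A : ℝ} (hA0 : 0 < A) (hαA : ∀ n, A ≤ α n)
    (u : ℕ → X) (hu0 : u 0 ∈ E)
    (hu : ∀ n, u (n+1) = (1 - α n) • u n + α n • T (u n))
    (k : ℕ) (hk : 2 ≤ k)
    (β : ℕ → ℕ → ℝ) (hβ : ∀ n i, 1 ≤ i → i ≤ k - 1 → β n i ∈ Set.Ico (0:ℝ) 1)
    (x : ℕ → X) (y : ℕ → ℕ → X) (hx0 : x 0 = u 0)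
    (hytop : ∀ n, y n (k-1) = (1 - β n (k-1)) • x n + β n (k-1) • T (x n))
    (hyi : ∀ n i, 1 ≤ i → i ≤ k - 2 →
      y n i = (1 - β n i) • x n + β n i • T (y n (i+1)))
    (hx : ∀ n, x (n+1) = (1 - α n) • x n + α n • T (y n 1))
    : Tendsto u atTop (𝓝 p) ↔ Tendsto x atTop (𝓝 p) := by
  have hTp : ∀ w ∈ E, ‖T w - p‖ ≤ δ * ‖w - p‖ := by
    intro w hw
    have h := hT p hpE w hw
    rw [hfix, sub_self, norm_zero, hφ0, add_zero, norm_sub_rev, norm_sub_rev p w] at h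
    exact h
  have step : ∀ z ∈ E, ∀ w ∈ E, ‖w - p‖ ≤ ‖z - p‖ → ∀ a ∈ Set.Ico (0:ℝ) 1,
      ((1 - a) • z + a • T w) ∈ E ∧
      ‖((1 - a) • z + a • T w) - p‖ ≤ (1 - a * (1 - δ)) * ‖z - p‖ := by
    intro z hz w hw hwz a ha
    have ha1 : 0 ≤ 1 - a := by linarith [ha.2]
    refine ⟨hEcv hz (hTE hw) ha1 ha.1 (by ring), ?_⟩
    have e : ((1 - a) • z + a • T w) - p = (1 - a) • (z - p) + a • (T w - p) := by
      module
    rw [e]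
    refine (norm_add_le _ _).trans ?_
    rw [norm_smul, norm_smul, Real.norm_of_nonneg ha1, Real.norm_of_nonneg ha.1]
    have h1 : ‖T w - p‖ ≤ δ * ‖z - p‖ :=
      (hTp w hw).trans (mul_le_mul_of_nonneg_left hwz hδ0)
    have h2 := mul_le_mul_of_nonneg_left h1 ha.1
    linarith
  have weak : ∀ a ∈ Set.Ico (0:ℝ) 1, ∀ t : ℝ, 0 ≤ t → (1 - a * (1 - δ)) * t ≤ t := by
    intro a ha t ht
    have := mul_nonneg (mul_nonneg ha.1 (by linarith : 0 ≤ 1 - δ)) ht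
    linarith
  have hA1 : A < 1 := (hαA 0).trans_lt (hα 0).2
  have hq0 : 0 ≤ 1 - A * (1 - δ) := by nlinarith
  have hq1 : 1 - A * (1 - δ) < 1 := by nlinarith
  have conv : ∀ v : ℕ → X, v 0 ∈ E → (∀ n, v n ∈ E → v (n+1) ∈ E ∧
      ‖v (n+1) - p‖ ≤ (1 - α n * (1 - δ)) * ‖v n - p‖) → Tendsto v atTop (𝓝 p) := by
    intro v h0 hs
    have hE : ∀ n, v n ∈ E := fun n => by
      induction n with
      | zero => exact h0
      | succ n ih => exact (hs n ih).1
    have hb : ∀ n, ‖v n - p‖ ≤ (1 - A * (1 - δ)) ^ n * ‖v 0 - p‖ := fun n => by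
      induction n with
      | zero => simp
      | succ n ih =>
        have h1 : (1 - α n * (1 - δ)) ≤ 1 - A * (1 - δ) := by
          have := mul_le_mul_of_nonneg_right (hαA n) (by linarith : 0 ≤ 1 - δ)
          linarith
        calc ‖v (n+1) - p‖ ≤ (1 - α n * (1 - δ)) * ‖v n - p‖ := (hs n (hE n)).2
          _ ≤ (1 - A * (1 - δ)) * ‖v n - p‖ := mul_le_mul_of_nonneg_right h1 (norm_nonneg _)
          _ ≤ (1 - A * (1 - δ)) * ((1 - A * (1 - δ)) ^ n * ‖v 0 - p‖) :=
            mul_le_mul_of_nonneg_left ih hq0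
          _ = _ := by ring
    rw [tendsto_iff_norm_sub_tendsto_zero]
    refine squeeze_zero (fun n => norm_nonneg _) hb ?_
    simpa using (tendsto_pow_atTop_nhds_zero_of_lt_one hq0 hq1).mul_const ‖v 0 - p‖
  have hU : Tendsto u atTop (𝓝 p) := by
    refine conv u hu0 fun n hn => ?_
    rw [hu n]
    exact step _ hn _ hn le_rfl _ (hα n)
  have hX : Tendsto x atTop (𝓝 p) := by
    refine conv x (hx0 ▸ hu0) fun n hn => ?_
    have hy : ∀ j, j ≤ k - 2 → y n (k - 1 - j) ∈ E ∧ ‖y n (k - 1 - j) - p‖ ≤ ‖x n - p‖ := by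
      intro j
      induction j with
      | zero =>
        intro _
        have hb := hβ n (k-1) (by omega) le_rfl
        rw [Nat.sub_zero, hytop n]
        obtain ⟨h1, h2⟩ := step _ hn _ hn le_rfl _ hb
        exact ⟨h1, h2.trans (weak _ hb _ (norm_nonneg _))⟩
      | succ j ih =>
        intro hj
        obtain ⟨i1, i2⟩ := ih (by omega)
        have hb := hβ n (k-1-(j+1)) (by omega) (by omega)
        have hidx : k - 1 - (j+1) + 1 = k - 1 - j := by omega
        rw [hyi n (k-1-(j+1)) (by omega) (by omega), hidx]
        obtain ⟨h1, h2⟩ := step _ hn _ i1 i2 _ hb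
        exact ⟨h1, h2.trans (weak _ hb _ (norm_nonneg _))⟩
    have h1 := hy (k-2) le_rfl
    have hidx : k - 1 - (k - 2) = 1 := by omega
    rw [hidx] at h1
    rw [hx n]
    exact step _ hn _ h1.1 h1.2 _ (hα n)
  exact ⟨fun _ => hX, fun _ => hU⟩
end

section
/- Let X be a real Banach space, E a nonempty closed convex subset of X, T : E → E a contractive-like map with fixed point p, and fix k ≥ 2. Let (α_n), (β_n) and (β_n^i), i = 1,…,k−1, be sequences in [0,1) with α_n ≥ A > 0 for all n. Let (x_n) be the new multistep iteration and (v_n) the S-iteration, both started at the same point x_0 = v_0 ∈ E. Then x_n → p if and only if v_n → p. -/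
open Filter Topology

/-- Geometric decay of the distance to `p` forces convergence. -/
lemma tendsto_of_geom_s18 {X : Type*} [NormedAddCommGroup X] (u : ℕ → X) (p : X) (c : ℝ)
    (h0 : 0 ≤ c) (h1 : c < 1) (h : ∀ n, ‖u (n+1) - p‖ ≤ c * ‖u n - p‖) :
    Filter.Tendsto u Filter.atTop (nhds p) := by
  have hb : ∀ n, ‖u n - p‖ ≤ c ^ n * ‖u 0 - p‖ := by
    intro n
    induction n with
    | zero => simp
    | succ n ih =>
      calc ‖u (n+1) - p‖ ≤ c * ‖u n - p‖ := h n
        _ ≤ c * (c ^ n * ‖u 0 - p‖) := mul_le_mul_of_nonneg_left ih h0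
        _ = c ^ (n+1) * ‖u 0 - p‖ := by ring
  rw [tendsto_iff_norm_sub_tendsto_zero]
  refine squeeze_zero (fun _ => norm_nonneg _) hb ?_
  simpa using (tendsto_pow_atTop_nhds_zero_of_lt_one h0 h1).mul_const ‖u 0 - p‖

lemma norm_comb_sub_le {X : Type*} [NormedAddCommGroup X] [NormedSpace ℝ X]
    (a b p : X) (t : ℝ) (h0 : 0 ≤ t) (h1 : t ≤ 1) :
    ‖(1 - t) • a + t • b - p‖ ≤ (1 - t) * ‖a - p‖ + t * ‖b - p‖ := by
  have e : (1 - t) • a + t • b - p = (1 - t) • (a - p) + t • (b - p) := by module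
  rw [e]
  refine (norm_add_le _ _).trans_eq ?_
  rw [norm_smul, norm_smul, Real.norm_of_nonneg h0, Real.norm_of_nonneg (sub_nonneg.2 h1)]

theorem stmt18 {X : Type*} [NormedAddCommGroup X] [NormedSpace ℝ X] [CompleteSpace X]
    {E : Set X} (hEne : E.Nonempty) (hEcl : IsClosed E) (hEcv : Convex ℝ E)
    {T : X → X} (hTE : Set.MapsTo T E E)
    {δ : ℝ} (hδ0 : 0 ≤ δ) (hδ1 : δ < 1)
    {φ : ℝ → ℝ} (hφ0 : φ 0 = 0) (hφmono : StrictMonoOn φ (Set.Ici 0))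
    (hφcont : ContinuousOn φ (Set.Ici 0)) (hφnonneg : ∀ t, 0 ≤ t → 0 ≤ φ t)
    (hT : ∀ x ∈ E, ∀ y ∈ E, ‖T x - T y‖ ≤ δ * ‖x - y‖ + φ ‖x - T x‖)
    {p : X} (hpE : p ∈ E) (hfix : T p = p)
    (α : ℕ → ℝ) (hα : ∀ n, α n ∈ Set.Ico (0:ℝ) 1)
    {A : ℝ} (hA0 : 0 < A) (hαA : ∀ n, A ≤ α n)
    (k : ℕ) (hk : 2 ≤ k)
    (β' : ℕ → ℕ → ℝ) (hβ' : ∀ n i, 1 ≤ i → i ≤ k - 1 → β' n i ∈ Set.Ico (0:ℝ) 1)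
    (x : ℕ → X) (y : ℕ → ℕ → X) (hx0 : x 0 ∈ E)
    (hytop : ∀ n, y n (k-1) = (1 - β' n (k-1)) • x n + β' n (k-1) • T (x n))
    (hyi : ∀ n i, 1 ≤ i → i ≤ k - 2 →
      y n i = (1 - β' n i) • y n (i+1) + β' n i • T (y n (i+1)))
    (hx : ∀ n, x (n+1) = (1 - α n) • y n 1 + α n • T (y n 1))
    (β : ℕ → ℝ) (hβ : ∀ n, β n ∈ Set.Ico (0:ℝ) 1)
    (v w : ℕ → X) (hv0 : v 0 = x 0)
    (hw : ∀ n, w n = (1 - β n) • v n + β n • T (v n))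
    (hv : ∀ n, v (n+1) = (1 - α n) • T (v n) + α n • T (w n))
    : Tendsto x atTop (𝓝 p) ↔ Tendsto v atTop (𝓝 p) := by
  have hTp : ∀ z ∈ E, ‖T z - p‖ ≤ δ * ‖z - p‖ := by
    intro z hz
    have h := hT p hpE z hz
    rw [hfix, sub_self, norm_zero, hφ0, add_zero] at h
    rwa [norm_sub_rev, norm_sub_rev z p]
  have hmem : ∀ a ∈ E, ∀ b ∈ E, ∀ t ∈ Set.Ico (0:ℝ) 1, (1 - t) • a + t • b ∈ E := by
    intro a ha b hb t ht
    exact hEcv ha hb (by linarith [ht.2]) ht.1 (by ring)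
  have hstep : ∀ z ∈ E, ∀ t ∈ Set.Ico (0:ℝ) 1,
      ‖(1 - t) • z + t • T z - p‖ ≤ (1 - t * (1 - δ)) * ‖z - p‖ := by
    intro z hz t ht
    have h1 := norm_comb_sub_le z (T z) p t ht.1 ht.2.le
    have h2 := mul_le_mul_of_nonneg_left (hTp z hz) ht.1
    linarith
  have hstep1 : ∀ z ∈ E, ∀ t ∈ Set.Ico (0:ℝ) 1,
      ‖(1 - t) • z + t • T z - p‖ ≤ ‖z - p‖ := by
    intro z hz t ht
    have h1 := hstep z hz t ht
    have h2 : 0 ≤ t * (1 - δ) * ‖z - p‖ :=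
      mul_nonneg (mul_nonneg ht.1 (by linarith)) (norm_nonneg _)
    linarith
  have hyE : ∀ n, x n ∈ E → y n 1 ∈ E ∧ ‖y n 1 - p‖ ≤ ‖x n - p‖ := by
    intro n hn
    have key : ∀ j, j ≤ k - 2 →
        y n (k - 1 - j) ∈ E ∧ ‖y n (k - 1 - j) - p‖ ≤ ‖x n - p‖ := by
      intro j
      induction j with
      | zero =>
        intro _
        have hb := hβ' n (k - 1) (by omega) le_rfl
        rw [Nat.sub_zero, hytop n]
        exact ⟨hmem _ hn _ (hTE hn) _ hb, hstep1 _ hn _ hb⟩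
      | succ j ih =>
        intro hj
        obtain ⟨h1, h2⟩ := ih (by omega)
        have hb := hβ' n (k - 1 - (j + 1)) (by omega) (by omega)
        have e := hyi n (k - 1 - (j + 1)) (by omega) (by omega)
        have e' : k - 1 - (j + 1) + 1 = k - 1 - j := by omega
        rw [e'] at e
        rw [e]
        exact ⟨hmem _ h1 _ (hTE h1) _ hb, (hstep1 _ h1 _ hb).trans h2⟩
    have h := key (k - 2) le_rfl
    have e : k - 1 - (k - 2) = 1 := by omega
    rwa [e] at h
  have hxE : ∀ n, x n ∈ E := by
    intro n
    induction n with
    | zero => exact hx0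
    | succ n ih =>
      rw [hx n]
      exact hmem _ (hyE n ih).1 _ (hTE (hyE n ih).1) _ (hα n)
  have hwE : ∀ n, v n ∈ E → w n ∈ E := by
    intro n hn
    rw [hw n]
    exact hmem _ hn _ (hTE hn) _ (hβ n)
  have hvE : ∀ n, v n ∈ E := by
    intro n
    induction n with
    | zero => rw [hv0]; exact hx0
    | succ n ih =>
      rw [hv n]
      exact hmem _ (hTE ih) _ (hTE (hwE n ih)) _ (hα n)
  have hA1 : A < 1 := (hαA 0).trans_lt (hα 0).2
  have hX : Tendsto x atTop (𝓝 p) := by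
    refine tendsto_of_geom_s18 x p (1 - A * (1 - δ)) (by nlinarith) (by nlinarith) ?_
    intro n
    obtain ⟨h1, h2⟩ := hyE n (hxE n)
    rw [hx n]
    refine (hstep _ h1 _ (hα n)).trans ?_
    refine mul_le_mul ?_ h2 (norm_nonneg _) (by nlinarith)
    have := mul_le_mul_of_nonneg_right (hαA n) (sub_nonneg.2 hδ1.le)
    linarith
  have hV : Tendsto v atTop (𝓝 p) := by
    refine tendsto_of_geom_s18 v p δ hδ0 hδ1 ?_
    intro n
    have hwn := hwE n (hvE n)
    have h1 := norm_comb_sub_le (T (v n)) (T (w n)) p (α n) (hα n).1 (hα n).2.le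
    have h2 : ‖w n - p‖ ≤ ‖v n - p‖ := by
      rw [hw n]; exact hstep1 _ (hvE n) _ (hβ n)
    have h3 : ‖T (w n) - p‖ ≤ δ * ‖v n - p‖ :=
      (hTp _ hwn).trans (mul_le_mul_of_nonneg_left h2 hδ0)
    have h4 := mul_le_mul_of_nonneg_left h3 (hα n).1
    have h5 := mul_le_mul_of_nonneg_left (hTp _ (hvE n)) (sub_nonneg.2 (hα n).2.le)
    rw [hv n]
    linarith
  exact ⟨fun _ => hV, fun _ => hX⟩
end

section
/- Let X be a real Banach space, E a subset of X, and T : E → E a Zamfirescu mapping with constants a, b, c. Set δ = max{a, b/(1−b), c/(1−c)}. Then δ ∈ [0,1) and for all x, y ∈ E, ‖Tx − Ty‖ ≤ δ‖x − y‖ + 2δ‖x − Tx‖. -/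
open Filter Topology

theorem stmt19 {X : Type*} [NormedAddCommGroup X] [NormedSpace ℝ X] [CompleteSpace X]
    (E : Set X) {T : X → X} (hTE : Set.MapsTo T E E)
    (a b c : ℝ) (ha0 : 0 < a) (ha1 : a < 1)
    (hb0 : 0 < b) (hb1 : b < 1/2) (hc0 : 0 < c) (hc1 : c < 1/2)
    (hz : ∀ x ∈ E, ∀ y ∈ E,
      ‖T x - T y‖ ≤ a * ‖x - y‖ ∨
      ‖T x - T y‖ ≤ b * (‖x - T x‖ + ‖y - T y‖) ∨
      ‖T x - T y‖ ≤ c * (‖x - T y‖ + ‖y - T x‖)) :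
    (0 ≤ max a (max (b / (1 - b)) (c / (1 - c))) ∧
      max a (max (b / (1 - b)) (c / (1 - c))) < 1) ∧
    ∀ x ∈ E, ∀ y ∈ E,
      ‖T x - T y‖ ≤ max a (max (b / (1 - b)) (c / (1 - c))) * ‖x - y‖
        + 2 * max a (max (b / (1 - b)) (c / (1 - c))) * ‖x - T x‖ := by
  have hb' : 0 < 1 - b := by linarith
  have hc' : 0 < 1 - c := by linarith
  have h1 : a ≤ max a (max (b / (1 - b)) (c / (1 - c))) := le_max_left _ _
  have h2 : b / (1 - b) ≤ max a (max (b / (1 - b)) (c / (1 - c))) :=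
    (le_max_left _ _).trans (le_max_right _ _)
  have h3 : c / (1 - c) ≤ max a (max (b / (1 - b)) (c / (1 - c))) :=
    (le_max_right _ _).trans (le_max_right _ _)
  have h4 : max a (max (b / (1 - b)) (c / (1 - c))) < 1 := by
    refine max_lt ha1 (max_lt ?_ ?_)
    · rw [div_lt_one hb']; linarith
    · rw [div_lt_one hc']; linarith
  generalize max a (max (b / (1 - b)) (c / (1 - c))) = δ at *
  have h0 : 0 ≤ δ := ha0.le.trans h1
  refine ⟨⟨h0, h4⟩, fun x hx y hy => ?_⟩
  have hd := norm_nonneg (x - y)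
  have hp := norm_nonneg (x - T x)
  have key : ∀ t : ℝ, 0 < 1 - t → t / (1 - t) ≤ δ →
      ‖T x - T y‖ ≤ t * (‖x - y‖ + 2 * ‖x - T x‖ + ‖T x - T y‖) →
      ‖T x - T y‖ ≤ δ * ‖x - y‖ + 2 * δ * ‖x - T x‖ := by
    intro t ht htd h
    have e : ‖T x - T y‖ ≤ t / (1 - t) * (‖x - y‖ + 2 * ‖x - T x‖) := by
      rw [div_mul_eq_mul_div, le_div_iff₀ ht]; linarith
    have := mul_le_mul_of_nonneg_right htd
      (show 0 ≤ ‖x - y‖ + 2 * ‖x - T x‖ by positivity)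
    linarith
  have hyx : ‖y - x‖ = ‖x - y‖ := norm_sub_rev _ _
  have t1 : ‖y - T x‖ ≤ ‖y - x‖ + ‖x - T x‖ := norm_sub_le_norm_sub_add_norm_sub _ _ _
  have t2 : ‖y - T y‖ ≤ ‖y - T x‖ + ‖T x - T y‖ := norm_sub_le_norm_sub_add_norm_sub _ _ _
  have t3 : ‖x - T y‖ ≤ ‖x - T x‖ + ‖T x - T y‖ := norm_sub_le_norm_sub_add_norm_sub _ _ _
  rcases hz x hx y hy with h | h | h
  · have := mul_le_mul_of_nonneg_right h1 hd
    have := mul_nonneg h0 hp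
    linarith
  · exact key b hb' h2 (h.trans (mul_le_mul_of_nonneg_left (by linarith) hb0.le))
  · exact key c hc' h3 (h.trans (mul_le_mul_of_nonneg_left (by linarith) hc0.le))
end
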